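/- Let γ ≥ 1, p > γ + 1, and let q = p/(p−1) be the Hölder conjugate of p. There exists a constant C > 0 such that for every ε > 0 and every smooth compactly supported f: ℝⁿ × ℝᵐ → ℝ, the q-super-Poincaré inequality ∫ |f|^q dμ ≤ ε ∫ |∇_γ f|^q dμ + exp(C(1 + ε^{−(γ+1)(p−1)/(p−γ−1)})) (∫ |f|^{q/2} dμ)² holds. -/

import Mathlib

open MeasureTheory

/-- The Grushin Kaplan norm `N(x,y) = (|x|^{2(1+γ)} + (1+γ)²|y|²)^{1/(2+2γ)}` on `ℝⁿ × ℝᵐ`. -/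
noncomputable def GKaplan (n m : ℕ) (γ : ℝ)
    (w : EuclideanSpace ℝ (Fin n) × EuclideanSpace ℝ (Fin m)) : ℝ :=
  (‖w.1‖ ^ (2 * (1 + γ)) + (1 + γ) ^ 2 * ‖w.2‖ ^ 2) ^ (1 / (2 + 2 * γ))

/-- Partial derivative `∂_{x_i} f` in the `i`-th coordinate of the `x`-variable. -/
noncomputable def dX (n m : ℕ)
    (f : EuclideanSpace ℝ (Fin n) × EuclideanSpace ℝ (Fin m) → ℝ)
    (w : EuclideanSpace ℝ (Fin n) × EuclideanSpace ℝ (Fin m)) (i : Fin n) : ℝ :=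
  fderiv ℝ f w (EuclideanSpace.single i (1 : ℝ), 0)

/-- Partial derivative `∂_{y_j} f` in the `j`-th coordinate of the `y`-variable. -/
noncomputable def dY (n m : ℕ)
    (f : EuclideanSpace ℝ (Fin n) × EuclideanSpace ℝ (Fin m) → ℝ)
    (w : EuclideanSpace ℝ (Fin n) × EuclideanSpace ℝ (Fin m)) (j : Fin m) : ℝ :=
  fderiv ℝ f w (0, EuclideanSpace.single j (1 : ℝ))

/-- The squared length of the Grushin subgradient:
`|∇_γ f|² = |∇_x f|² + |x|^{2γ} |∇_y f|²`. -/
noncomputable def gradSqG (n m : ℕ) (γ : ℝ)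
    (f : EuclideanSpace ℝ (Fin n) × EuclideanSpace ℝ (Fin m) → ℝ)
    (w : EuclideanSpace ℝ (Fin n) × EuclideanSpace ℝ (Fin m)) : ℝ :=
  (∑ i, (dX n m f w i) ^ 2) + ‖w.1‖ ^ (2 * γ) * ∑ j, (dY n m f w j) ^ 2

/-- The probability measure `dμ = Z⁻¹ e^{-N^p} dξ` on `ℝⁿ × ℝᵐ` in the Grushin setting. -/
noncomputable def muG (n m : ℕ) (γ p : ℝ) :
    Measure (EuclideanSpace ℝ (Fin n) × EuclideanSpace ℝ (Fin m)) :=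
  volume.withDensity (fun w => ENNReal.ofReal
    ((∫ v : EuclideanSpace ℝ (Fin n) × EuclideanSpace ℝ (Fin m),
        Real.exp (-(GKaplan n m γ v) ^ p))⁻¹ * Real.exp (-(GKaplan n m γ w) ^ p)))

open scoped ENNReal

/-- Displacing a function along a measure preserving flow is controlled by the derivative of the
function along the flow. -/
lemma lintegral_flow_sub_le {Ω : Type*} [MeasurableSpace Ω] (μ : Measure Ω) [SFinite μ]
    (T : ℝ → Ω → Ω) (hTm : Measurable fun a : ℝ × Ω => T a.1 a.2)
    (hT : ∀ t, MeasurePreserving (T t) μ μ) (h0 : ∀ z, T 0 z = z) (F F' : Ω → ℝ)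
    (hF' : Measurable F') (hd : ∀ z t, HasDerivAt (fun t => F (T t z)) (F' (T t z)) t)
    (hc : ∀ z, Continuous fun t => F' (T t z)) {q : ℝ} (hq : 1 ≤ q) (w w' : Ω → ℝ≥0∞)
    (hw' : Measurable w') (hw : ∀ z, ∀ t ∈ Set.Ioc (0 : ℝ) 1, w z ≤ w' (T t z)) :
    ∫⁻ z, w z * ENNReal.ofReal (|F (T 1 z) - F z| ^ q) ∂μ
      ≤ ∫⁻ z, w' z * ENNReal.ofReal (|F' z| ^ q) ∂μ := by
  have key : ∀ z, ENNReal.ofReal (|F (T 1 z) - F z| ^ q)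
      ≤ ∫⁻ t in Set.Ioc (0 : ℝ) 1, ENNReal.ofReal (|F' (T t z)| ^ q) := by
    intro z
    have e1 : F (T 1 z) - F z = ∫ t in (0 : ℝ)..1, F' (T t z) := by
      rw [intervalIntegral.integral_eq_sub_of_hasDerivAt (fun t _ => hd z t)
        ((hc z).intervalIntegrable _ _), h0]
    have hcq : Continuous fun t => |F' (T t z)| ^ q :=
      (hc z).abs.rpow_const fun _ => Or.inr (by linarith)
    have : IsProbabilityMeasure (volume.restrict (Set.Ioc (0 : ℝ) 1)) := ⟨by simp⟩
    have i1 : Integrable (fun t => |F' (T t z)|) (volume.restrict (Set.Ioc (0 : ℝ) 1)) :=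
      (hc z).abs.integrableOn_Ioc
    have i2 : Integrable (fun t => |F' (T t z)| ^ q) (volume.restrict (Set.Ioc (0 : ℝ) 1)) :=
      hcq.integrableOn_Ioc
    have e2 : |F (T 1 z) - F z| ≤ ∫ t in Set.Ioc (0 : ℝ) 1, |F' (T t z)| := by
      rw [e1, intervalIntegral.integral_of_le zero_le_one]
      exact abs_integral_le_integral_abs
    have e3 := (convexOn_rpow hq).map_integral_le
      (continuousOn_id.rpow_const fun _ _ => Or.inr (by linarith)) isClosed_Ici
      (Filter.Eventually.of_forall fun t => abs_nonneg (F' (T t z))) i1 i2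
    calc ENNReal.ofReal (|F (T 1 z) - F z| ^ q)
        ≤ ENNReal.ofReal (∫ t in Set.Ioc (0 : ℝ) 1, |F' (T t z)| ^ q) := by
          apply ENNReal.ofReal_le_ofReal
          exact (Real.rpow_le_rpow (abs_nonneg _) e2 (by linarith)).trans e3
      _ = _ := ofReal_integral_eq_lintegral_ofReal i2
          (Filter.Eventually.of_forall fun t => by positivity)
  have hm : Measurable fun z => w' z * ENNReal.ofReal (|F' z| ^ q) := by fun_prop
  calc ∫⁻ z, w z * ENNReal.ofReal (|F (T 1 z) - F z| ^ q) ∂μ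
      ≤ ∫⁻ z, (∫⁻ t in Set.Ioc (0 : ℝ) 1,
          w' (T t z) * ENNReal.ofReal (|F' (T t z)| ^ q)) ∂μ := by
        refine lintegral_mono fun z => ?_
        calc w z * ENNReal.ofReal (|F (T 1 z) - F z| ^ q)
            ≤ w z * ∫⁻ t in Set.Ioc (0 : ℝ) 1, ENNReal.ofReal (|F' (T t z)| ^ q) := by
              gcongr; exact key z
          _ ≤ ∫⁻ t in Set.Ioc (0 : ℝ) 1, w z * ENNReal.ofReal (|F' (T t z)| ^ q) :=
              lintegral_const_mul_le _ _
          _ ≤ _ := by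
              refine setLIntegral_mono' measurableSet_Ioc fun t ht => ?_
              gcongr; exact hw z t ht
    _ = ∫⁻ t in Set.Ioc (0 : ℝ) 1, (∫⁻ z,
          w' (T t z) * ENNReal.ofReal (|F' (T t z)| ^ q) ∂μ) := by
        rw [lintegral_lintegral_swap]
        exact (hm.comp (hTm.comp measurable_swap)).aemeasurable
    _ = ∫⁻ _ in Set.Ioc (0 : ℝ) 1, (∫⁻ z, w' z * ENNReal.ofReal (|F' z| ^ q) ∂μ) := by
        refine lintegral_congr fun t => ?_
        exact (hT t).lintegral_comp hm
    _ = _ := by simp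

/-- `ℝⁿ × ℝᵐ` with Euclidean factors. -/
abbrev GrushinSpace (n m : ℕ) := EuclideanSpace ℝ (Fin n) × EuclideanSpace ℝ (Fin m)

section Grushin

variable {n m : ℕ}

lemma measurePreserving_shear {g : EuclideanSpace ℝ (Fin m) → EuclideanSpace ℝ (Fin n)}
    (hg : Measurable g) (k : EuclideanSpace ℝ (Fin m)) :
    MeasurePreserving (fun z : GrushinSpace n m => (z.1 + g z.2, z.2 + k)) volume volume := by
  have h1 : MeasurePreserving
      (fun w : EuclideanSpace ℝ (Fin m) × EuclideanSpace ℝ (Fin n) => (w.1 + k, w.2 + g w.1))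
      (volume.prod volume) (volume.prod volume) :=
    (measurePreserving_add_right volume k).skew_product (g := fun y x => x + g y)
      (by unfold Function.uncurry; fun_prop)
      (Filter.Eventually.of_forall fun y => (measurePreserving_add_right volume (g y)).map_eq)
  exact (Measure.measurePreserving_swap.comp h1).comp Measure.measurePreserving_swap

/-- The length of the Grushin subgradient. -/
noncomputable def gradNormG (γ : ℝ) (f : GrushinSpace n m → ℝ) (z : GrushinSpace n m) : ℝ :=
  √(gradSqG n m γ f z)

lemma abs_apply_le_sqrt_sum {ι : Type*} [Fintype ι] [DecidableEq ι]
    (L : EuclideanSpace ℝ ι →L[ℝ] ℝ) (v : EuclideanSpace ℝ ι) :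
    |L v| ≤ √(∑ i, L (EuclideanSpace.single i 1) ^ 2) * ‖v‖ := by
  have h1 : L v = ∑ i, L (EuclideanSpace.single i 1) * v i := by
    have hv : v = ∑ i, v i • EuclideanSpace.single i (1 : ℝ) := by
      simpa using ((EuclideanSpace.basisFun ι ℝ).sum_repr v).symm
    conv_lhs => rw [hv]
    simp [map_sum, mul_comm]
  rw [EuclideanSpace.norm_eq, ← Real.sqrt_mul (Finset.sum_nonneg fun _ _ => sq_nonneg _),
    ← Real.sqrt_sq_eq_abs]
  apply Real.sqrt_le_sqrt
  rw [h1]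
  simpa using Finset.sum_mul_sq_le_sq_mul_sq Finset.univ
    (fun i => L (EuclideanSpace.single i 1)) fun i => v i

lemma gradSqG_nonneg (γ : ℝ) (f : GrushinSpace n m → ℝ) (z : GrushinSpace n m) :
    0 ≤ gradSqG n m γ f z := by
  unfold gradSqG
  positivity

lemma gradNormG_nonneg (γ : ℝ) (f : GrushinSpace n m → ℝ) (z : GrushinSpace n m) :
    0 ≤ gradNormG γ f z := Real.sqrt_nonneg _

lemma abs_fderiv_fst_le (f : GrushinSpace n m → ℝ) (z : GrushinSpace n m)
    (v : EuclideanSpace ℝ (Fin n)) :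
    |fderiv ℝ f z (v, 0)| ≤ √(∑ i, dX n m f z i ^ 2) * ‖v‖ :=
  abs_apply_le_sqrt_sum ((fderiv ℝ f z).comp (ContinuousLinearMap.inl ℝ _ _)) v

lemma abs_fderiv_snd_le (f : GrushinSpace n m → ℝ) (z : GrushinSpace n m)
    (v : EuclideanSpace ℝ (Fin m)) :
    |fderiv ℝ f z (0, v)| ≤ √(∑ j, dY n m f z j ^ 2) * ‖v‖ :=
  abs_apply_le_sqrt_sum ((fderiv ℝ f z).comp (ContinuousLinearMap.inr ℝ _ _)) v

lemma abs_fderiv_fst_le_gradNormG (γ : ℝ) (f : GrushinSpace n m → ℝ) (z : GrushinSpace n m)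
    (v : EuclideanSpace ℝ (Fin n)) :
    |fderiv ℝ f z (v, 0)| ≤ gradNormG γ f z * ‖v‖ := by
  refine (abs_fderiv_fst_le f z v).trans ?_
  gcongr
  apply Real.sqrt_le_sqrt
  unfold gradSqG
  have : 0 ≤ ‖z.1‖ ^ (2 * γ) * ∑ j, dY n m f z j ^ 2 := by positivity
  linarith

lemma abs_fderiv_snd_le_gradNormG (γ : ℝ) (f : GrushinSpace n m → ℝ) (z : GrushinSpace n m)
    (v : EuclideanSpace ℝ (Fin m)) :
    ‖z.1‖ ^ γ * |fderiv ℝ f z (0, v)| ≤ gradNormG γ f z * ‖v‖ := by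
  have h1 : ‖z.1‖ ^ γ * √(∑ j, dY n m f z j ^ 2) ≤ gradNormG γ f z := by
    apply Real.le_sqrt_of_sq_le
    rw [mul_pow, Real.sq_sqrt (by positivity), ← Real.rpow_natCast, ← Real.rpow_mul (norm_nonneg _)]
    unfold gradSqG
    have : 0 ≤ ∑ i, dX n m f z i ^ 2 := by positivity
    rw [mul_comm γ]
    push_cast
    linarith
  calc _ ≤ ‖z.1‖ ^ γ * (√(∑ j, dY n m f z j ^ 2) * ‖v‖) := by
        gcongr; exact abs_fderiv_snd_le f z v
    _ ≤ _ := by rw [← mul_assoc]; gcongr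

/-- Cauchy–Schwarz for the generator of the anisotropic dilations. -/
lemma rpow_mul_abs_fderiv_dilation_le (γ : ℝ) (hγ : 0 ≤ γ) (f : GrushinSpace n m → ℝ)
    (z : GrushinSpace n m) :
    ‖z.1‖ ^ γ * |fderiv ℝ f z (z.1, (1 + γ) • z.2)|
      ≤ gradNormG γ f z * √(‖z.1‖ ^ (2 * (1 + γ)) + (1 + γ) ^ 2 * ‖z.2‖ ^ 2) := by
  set A := √(∑ i, dX n m f z i ^ 2)
  set B := √(∑ j, dY n m f z j ^ 2)
  have hA : A ^ 2 = ∑ i, dX n m f z i ^ 2 := Real.sq_sqrt (by positivity)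
  have hB : B ^ 2 = ∑ j, dY n m f z j ^ 2 := Real.sq_sqrt (by positivity)
  have h1 : |fderiv ℝ f z (z.1, (1 + γ) • z.2)| ≤ A * ‖z.1‖ + B * ((1 + γ) * ‖z.2‖) := by
    have : (z.1, (1 + γ) • z.2) = (z.1, (0 : EuclideanSpace ℝ (Fin m))) +
      ((0 : EuclideanSpace ℝ (Fin n)), (1 + γ) • z.2) := by simp
    rw [this, map_add]
    refine (abs_add_le _ _).trans (add_le_add (abs_fderiv_fst_le f z z.1) ?_)
    refine (abs_fderiv_snd_le f z _).trans_eq ?_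
    rw [norm_smul, Real.norm_of_nonneg (by linarith)]
  have hr : ‖z.1‖ ^ (2 * γ) = (‖z.1‖ ^ γ) ^ 2 := by
    rw [← Real.rpow_natCast, ← Real.rpow_mul (norm_nonneg _), mul_comm]; norm_num
  have hr' : ‖z.1‖ ^ (2 * (1 + γ)) = (‖z.1‖ * ‖z.1‖ ^ γ) ^ 2 := by
    have : ‖z.1‖ * ‖z.1‖ ^ γ = ‖z.1‖ ^ (1 + γ) := by
      rw [Real.rpow_add_of_nonneg (norm_nonneg _) zero_le_one hγ, Real.rpow_one]
    rw [this, ← Real.rpow_natCast, ← Real.rpow_mul (norm_nonneg _), mul_comm]; norm_num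
  unfold gradNormG gradSqG
  rw [← Real.sqrt_mul (by positivity), ← hA, ← hB, hr, hr']
  apply Real.le_sqrt_of_sq_le
  set r := ‖z.1‖ ^ γ
  have hr0 : 0 ≤ r := by positivity
  calc (r * |fderiv ℝ f z (z.1, (1 + γ) • z.2)|) ^ 2
      ≤ (r * (A * ‖z.1‖ + B * ((1 + γ) * ‖z.2‖))) ^ 2 := by gcongr
    _ ≤ _ := by nlinarith [sq_nonneg (A * ((1 + γ) * ‖z.2‖) - r * B * (‖z.1‖ * r))]

variable {γ : ℝ}

lemma GKaplan_rpow (hγ : 0 ≤ γ) (p : ℝ) (z : GrushinSpace n m) :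
    GKaplan n m γ z ^ p =
      (‖z.1‖ ^ (2 * (1 + γ)) + (1 + γ) ^ 2 * ‖z.2‖ ^ 2) ^ (p / (2 + 2 * γ)) := by
  unfold GKaplan
  rw [← Real.rpow_mul (by positivity)]
  congr 1
  ring

lemma GKaplan_nonneg (hγ : 0 ≤ γ) (z : GrushinSpace n m) : 0 ≤ GKaplan n m γ z := by
  unfold GKaplan
  positivity

lemma GKaplan_rpow_one_add (hγ : 0 ≤ γ) (z : GrushinSpace n m) :
    GKaplan n m γ z ^ (1 + γ) =
      √(‖z.1‖ ^ (2 * (1 + γ)) + (1 + γ) ^ 2 * ‖z.2‖ ^ 2) := by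
  rw [GKaplan_rpow hγ, Real.sqrt_eq_rpow]
  congr 1
  field_simp

lemma norm_fst_le_GKaplan (hγ : 0 ≤ γ) (z : GrushinSpace n m) : ‖z.1‖ ≤ GKaplan n m γ z := by
  have h : ‖z.1‖ ^ (1 + γ) ≤ GKaplan n m γ z ^ (1 + γ) := by
    rw [GKaplan_rpow_one_add hγ]
    apply Real.le_sqrt_of_sq_le
    rw [← Real.rpow_natCast, ← Real.rpow_mul (norm_nonneg _)]
    have : 0 ≤ (1 + γ) ^ 2 * ‖z.2‖ ^ 2 := by positivity
    rw [mul_comm (1 + γ)]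
    push_cast
    linarith
  exact (Real.rpow_le_rpow_iff (norm_nonneg _) (GKaplan_nonneg hγ z) (by linarith)).1 h

lemma norm_snd_le_GKaplan_rpow (hγ : 0 ≤ γ) (z : GrushinSpace n m) :
    ‖z.2‖ ≤ GKaplan n m γ z ^ (1 + γ) := by
  rw [GKaplan_rpow_one_add hγ]
  apply Real.le_sqrt_of_sq_le
  have h0 : 0 ≤ ‖z.1‖ ^ (2 * (1 + γ)) := by positivity
  have h1 : 0 ≤ (2 * γ + γ ^ 2) * ‖z.2‖ ^ 2 := by positivity
  nlinarith

lemma continuous_GKaplan (hγ : 0 ≤ γ) : Continuous (GKaplan n m γ) := by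
  unfold GKaplan
  refine Continuous.rpow_const ?_ fun _ => Or.inr (by positivity)
  refine Continuous.add (Continuous.rpow_const (by fun_prop) fun _ => Or.inr (by positivity)) ?_
  fun_prop

/-- The anisotropic dilations of the Grushin space, in exponential parametrisation. -/
noncomputable def dilG (γ τ : ℝ) (z : GrushinSpace n m) : GrushinSpace n m :=
  (Real.exp τ • z.1, Real.exp ((1 + γ) * τ) • z.2)

lemma GKaplan_dilG (hγ : 0 ≤ γ) (τ : ℝ) (z : GrushinSpace n m) :
    GKaplan n m γ (dilG γ τ z) = Real.exp τ * GKaplan n m γ z := by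
  unfold GKaplan dilG
  simp only [norm_smul, Real.norm_eq_abs, Real.abs_exp]
  rw [Real.mul_rpow (Real.exp_pos _).le (norm_nonneg _), mul_pow, ← Real.exp_mul,
    ← Real.exp_nat_mul]
  have e : Real.exp (τ * (2 * (1 + γ))) * ‖z.1‖ ^ (2 * (1 + γ)) +
      (1 + γ) ^ 2 * (Real.exp ((2 : ℕ) * ((1 + γ) * τ)) * ‖z.2‖ ^ 2) =
      Real.exp (τ * (2 + 2 * γ)) *
        (‖z.1‖ ^ (2 * (1 + γ)) + (1 + γ) ^ 2 * ‖z.2‖ ^ 2) := by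
    rw [show τ * (2 * (1 + γ)) = τ * (2 + 2 * γ) by ring,
      show ((2 : ℕ) : ℝ) * ((1 + γ) * τ) = τ * (2 + 2 * γ) by push_cast; ring]
    ring
  rw [e, Real.mul_rpow (Real.exp_pos _).le (by positivity), ← Real.exp_mul]
  congr 2
  field_simp

lemma map_dilG (γ τ : ℝ) : Measure.map (dilG γ τ) (volume : Measure (GrushinSpace n m)) =
    ENNReal.ofReal (Real.exp (-((n + (1 + γ) * m) * τ))) • volume := by
  have h := Measure.map_prod_map (volume : Measure (EuclideanSpace ℝ (Fin n)))
    (volume : Measure (EuclideanSpace ℝ (Fin m)))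
    (f := fun x => Real.exp τ • x) (g := fun y => Real.exp ((1 + γ) * τ) • y)
    (by fun_prop) (by fun_prop)
  rw [Measure.map_addHaar_smul _ (Real.exp_pos _).ne',
    Measure.map_addHaar_smul _ (Real.exp_pos _).ne', Measure.prod_smul_left,
    Measure.prod_smul_right, smul_smul, ← ENNReal.ofReal_mul (abs_nonneg _)] at h
  refine h.symm.trans ?_
  congr 2
  rw [abs_of_pos (by positivity), abs_of_pos (by positivity), finrank_euclideanSpace_fin,
    finrank_euclideanSpace_fin, ← Real.exp_nat_mul, ← Real.exp_nat_mul, ← Real.exp_neg,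
    ← Real.exp_neg, ← Real.exp_add]
  congr 1
  ring

lemma measurable_dilG (γ τ : ℝ) : Measurable (dilG γ τ : GrushinSpace n m → GrushinSpace n m) := by
  unfold dilG
  fun_prop

lemma integral_comp_dilG (γ τ : ℝ) {Ψ : GrushinSpace n m → ℝ} (hΨ : Measurable Ψ) :
    Real.exp ((n + (1 + γ) * m) * τ) * ∫ z, Ψ (dilG γ τ z) = ∫ z, Ψ z := by
  rw [← integral_map (measurable_dilG γ τ).aemeasurable hΨ.aestronglyMeasurable, map_dilG,
    integral_smul_measure, ENNReal.toReal_ofReal (Real.exp_pos _).le, smul_eq_mul, ← mul_assoc,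
    ← Real.exp_add]
  simp

lemma dilG_dilG (γ s t : ℝ) (z : GrushinSpace n m) : dilG γ s (dilG γ t z) = dilG γ (s + t) z := by
  unfold dilG
  simp only [smul_smul, ← Real.exp_add, mul_add]

lemma dilG_zero (γ : ℝ) (z : GrushinSpace n m) : dilG γ 0 z = z := by
  simp [dilG]

lemma norm_dilG_le (hγ : 0 ≤ γ) {τ : ℝ} (hτ : |τ| ≤ 1) (z : GrushinSpace n m) :
    ‖dilG γ τ z‖ ≤ Real.exp (1 + γ) * ‖z‖ := by
  have h1 : τ ≤ 1 + γ := by linarith [(abs_le.1 hτ).2]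
  have h2 : (1 + γ) * τ ≤ 1 + γ := by nlinarith [(abs_le.1 hτ).2]
  unfold dilG
  refine max_le ?_ ?_
  · simp only [norm_smul, Real.norm_eq_abs, Real.abs_exp]
    gcongr
    exact norm_fst_le z
  · simp only [norm_smul, Real.norm_eq_abs, Real.abs_exp]
    gcongr
    exact norm_snd_le z

lemma hasDerivAt_dilG (γ τ : ℝ) (z : GrushinSpace n m) :
    HasDerivAt (fun τ => dilG γ τ z)
      ((dilG γ τ z).1, (1 + γ) • (dilG γ τ z).2) τ := by
  unfold dilG
  refine HasDerivAt.prodMk ?_ ?_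
  · exact (Real.hasDerivAt_exp τ).smul_const z.1
  · have := (((hasDerivAt_id τ).const_mul (1 + γ)).exp).smul_const z.2
    simpa [smul_smul, mul_comm] using this

/-- Integration by parts along the anisotropic dilations, against a dilation invariant weight. -/
lemma integral_add_mul_eq_zero_of_hasDerivAt_dilG (hγ : 0 ≤ γ) {G H θ : GrushinSpace n m → ℝ}
    (hG : Continuous G) (hGc : HasCompactSupport G) (hH : Continuous H)
    (hHc : HasCompactSupport H)
    (hd : ∀ z τ, HasDerivAt (fun τ => G (dilG γ τ z)) (H (dilG γ τ z)) τ)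
    (hθ : Measurable θ) (hθ1 : ∀ z, |θ z| ≤ 1) (hθd : ∀ τ z, θ (dilG γ τ z) = θ z) :
    ∫ z, (H z + (n + (1 + γ) * m) * G z) * θ z = 0 := by
  set Q : ℝ := n + (1 + γ) * m with hQ
  have hQ0 : 0 ≤ Q := by positivity
  obtain ⟨A, hA⟩ := hG.bounded_above_of_compact_support hGc
  obtain ⟨B, hB⟩ := hH.bounded_above_of_compact_support hHc
  obtain ⟨r₁, hr₁⟩ := hGc.isCompact.isBounded.subset_closedBall 0
  obtain ⟨r₂, hr₂⟩ := hHc.isCompact.isBounded.subset_closedBall 0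
  set r := max r₁ r₂
  have hGr : ∀ z, r < ‖z‖ → G z = 0 := fun z hz => by
    by_contra h
    have := hr₁ (subset_tsupport _ h)
    rw [mem_closedBall_zero_iff] at this
    exact absurd (this.trans (le_max_left _ _)) (not_le.2 hz)
  have hHr : ∀ z, r < ‖z‖ → H z = 0 := fun z hz => by
    by_contra h
    have := hr₂ (subset_tsupport _ h)
    rw [mem_closedBall_zero_iff] at this
    exact absurd (this.trans (le_max_right _ _)) (not_le.2 hz)
  have hdc : ∀ τ, Continuous (dilG γ τ : GrushinSpace n m → GrushinSpace n m) := fun τ => by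
    unfold dilG; fun_prop
  set F : ℝ → GrushinSpace n m → ℝ := fun τ z => Real.exp (Q * τ) * G (dilG γ τ z) * θ z
  set F' : ℝ → GrushinSpace n m → ℝ := fun τ z =>
    Real.exp (Q * τ) * (H (dilG γ τ z) + Q * G (dilG γ τ z)) * θ z
  have hFi : Integrable (F 0) := by
    have : F 0 = fun z => G z * θ z := by ext z; simp [F, dilG_zero]
    rw [this]
    refine (hG.integrable_of_hasCompactSupport hGc).mul_bdd (c := 1)
      hθ.aestronglyMeasurable (Filter.Eventually.of_forall fun z => ?_)
    exact hθ1 z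
  have hmain := hasDerivAt_integral_of_dominated_loc_of_deriv_le (μ := volume) (F := F) (F' := F')
    (x₀ := (0 : ℝ)) (s := Metric.closedBall 0 1)
    (bound := (Metric.closedBall (0 : GrushinSpace n m) (Real.exp (1 + γ) * r)).indicator
      fun _ => Real.exp Q * (B + Q * A))
    (Metric.closedBall_mem_nhds _ one_pos)
    (Filter.Eventually.of_forall fun τ => by
      have := (hG.comp (hdc τ)).measurable
      have h2 : Measurable fun z => G (dilG γ τ z) := this
      exact ((h2.const_mul _).mul hθ).aestronglyMeasurable)
    hFi
    (by
      have h1 : Measurable fun z => G (dilG γ 0 z) := (hG.comp (hdc 0)).measurable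
      have h2 : Measurable fun z => H (dilG γ 0 z) := (hH.comp (hdc 0)).measurable
      exact (((h2.add (h1.const_mul Q)).const_mul _).mul hθ).aestronglyMeasurable)
    (Filter.Eventually.of_forall fun z τ hτ => by
      rw [mem_closedBall_zero_iff, Real.norm_eq_abs] at hτ
      by_cases hz : z ∈ Metric.closedBall (0 : GrushinSpace n m) (Real.exp (1 + γ) * r)
      · rw [Set.indicator_of_mem hz]
        have e1 : Real.exp (Q * τ) ≤ Real.exp Q :=
          Real.exp_le_exp.2 (by nlinarith [(abs_le.1 hτ).2])
        have e2 : |H (dilG γ τ z) + Q * G (dilG γ τ z)| ≤ B + Q * A := by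
          refine (abs_add_le _ _).trans (add_le_add (hB _) ?_)
          rw [abs_mul, abs_of_nonneg hQ0]
          gcongr
          exact hA _
        simp only [F', norm_mul, Real.norm_eq_abs, Real.abs_exp]
        have e3 : 0 ≤ B + Q * A := (abs_nonneg _).trans e2
        calc _ ≤ Real.exp Q * (B + Q * A) * 1 := by
              gcongr
              exact hθ1 z
          _ = _ := mul_one _
      · have : r < ‖dilG γ τ z‖ := by
          by_contra! h
          apply hz
          rw [mem_closedBall_zero_iff]
          have h1 := norm_dilG_le hγ (τ := -τ) (by rwa [abs_neg]) (dilG γ τ z)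
          rw [dilG_dilG, neg_add_cancel, dilG_zero] at h1
          exact h1.trans (by gcongr)
        simp [F', hGr _ this, hHr _ this, Set.indicator_of_notMem hz])
    ((integrable_indicator_iff measurableSet_closedBall).2
      (integrableOn_const (measure_closedBall_lt_top).ne))
    (Filter.Eventually.of_forall fun z τ _ => by
      have h1 : HasDerivAt (fun τ => Real.exp (Q * τ)) (Real.exp (Q * τ) * Q) τ := by
        simpa using ((hasDerivAt_id τ).const_mul Q).exp
      refine ((h1.mul (hd z τ)).mul_const (θ z)).congr_deriv ?_
      simp only [F']
      ring)
  have hconst : (fun τ => ∫ z, F τ z) = fun _ => ∫ z, G z * θ z := by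
    ext τ
    refine Eq.trans ?_ (integral_comp_dilG γ τ (hG.measurable.mul hθ))
    rw [← integral_const_mul]
    refine integral_congr_ae (Filter.Eventually.of_forall fun z => ?_)
    simp only [F, hθd, hQ]
    ring
  have h0 := hmain.2
  rw [hconst] at h0
  have := h0.unique (hasDerivAt_const 0 _)
  simpa [F', dilG_zero] using this

/-- The dilation invariant ratio `(|x| / N)^{γq}`. -/
noncomputable def angleG (γ q : ℝ) (z : GrushinSpace n m) : ℝ :=
  (‖z.1‖ / GKaplan n m γ z) ^ (γ * q)

lemma angleG_nonneg (hγ : 0 ≤ γ) (q : ℝ) (z : GrushinSpace n m) : 0 ≤ angleG γ q z :=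
  Real.rpow_nonneg (div_nonneg (norm_nonneg _) (GKaplan_nonneg hγ z)) _

lemma angleG_le_one (hγ : 0 ≤ γ) {q : ℝ} (hq : 0 ≤ q) (z : GrushinSpace n m) :
    angleG γ q z ≤ 1 :=
  Real.rpow_le_one (div_nonneg (norm_nonneg _) (GKaplan_nonneg hγ z))
    (div_le_one_of_le₀ (norm_fst_le_GKaplan hγ z) (GKaplan_nonneg hγ z)) (by positivity)

lemma measurable_angleG (hγ : 0 ≤ γ) (q : ℝ) :
    Measurable (angleG γ q : GrushinSpace n m → ℝ) := by
  have := (continuous_GKaplan (n := n) (m := m) hγ).measurable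
  unfold angleG
  fun_prop

lemma angleG_dilG (hγ : 0 ≤ γ) (q τ : ℝ) (z : GrushinSpace n m) :
    angleG γ q (dilG γ τ z) = angleG γ q z := by
  unfold angleG
  rw [GKaplan_dilG hγ]
  congr 1
  simp only [dilG, norm_smul, Real.norm_eq_abs, Real.abs_exp]
  rw [mul_div_mul_left _ _ (Real.exp_pos _).ne']

lemma young_angleG {p q : ℝ} (hγ : 0 < γ) (hp : 1 < p) (hq : q = p / (p - 1))
    (f : GrushinSpace n m → ℝ) (z : GrushinSpace n m) :
    q * |f z| ^ (q - 1) * |fderiv ℝ f z (z.1, (1 + γ) • z.2)| * angleG γ q z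
      ≤ gradNormG γ f z ^ q +
        (q - 1) * (angleG γ q z * GKaplan n m γ z ^ p * |f z| ^ q) := by
  have hp1 : 0 < p - 1 := by linarith
  have hq0 : 0 < q := by rw [hq]; positivity
  have hq1 : q - 1 = 1 / (p - 1) := by rw [hq]; field_simp; ring
  have hqp : q - 1 = q / p := by rw [hq]; field_simp; ring
  have hq1' : 0 < q - 1 := by rw [hq1]; positivity
  have hN0 := GKaplan_nonneg hγ.le z
  have hθ := angleG_nonneg hγ.le q z
  have hΓ := gradNormG_nonneg γ f z
  rcases eq_or_ne ‖z.1‖ 0 with hr | hr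
  · have : angleG γ q z = 0 := by
      unfold angleG
      rw [hr, zero_div, Real.zero_rpow (by positivity)]
    rw [this]
    simp only [mul_zero, zero_mul, add_zero]
    positivity
  have hr0 : 0 < ‖z.1‖ := lt_of_le_of_ne (norm_nonneg _) hr.symm
  have hNpos : 0 < GKaplan n m γ z := hr0.trans_le (norm_fst_le_GKaplan hγ.le z)
  have hcs := rpow_mul_abs_fderiv_dilation_le γ hγ.le f z
  rw [← GKaplan_rpow_one_add hγ.le] at hcs
  set θ := angleG γ q z with hθdef
  set N := GKaplan n m γ z
  set D := |fderiv ℝ f z (z.1, (1 + γ) • z.2)|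
  set X := θ * N ^ (1 + γ) / ‖z.1‖ ^ γ with hX
  have hX0 : 0 ≤ X := by positivity
  have hDX : D * θ ≤ gradNormG γ f z * X := by
    have : D ≤ gradNormG γ f z * N ^ (1 + γ) / ‖z.1‖ ^ γ := by
      rw [le_div_iff₀ (by positivity)]
      linarith
    calc D * θ ≤ gradNormG γ f z * N ^ (1 + γ) / ‖z.1‖ ^ γ * θ := by gcongr
      _ = _ := by rw [hX]; ring
  have hXp : X ^ p = θ * N ^ p := by
    rw [hX, hθdef]
    unfold angleG
    obtain ⟨a, ha⟩ : ∃ a, Real.exp a = ‖z.1‖ := ⟨_, Real.exp_log hr0⟩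
    obtain ⟨b, hb⟩ : ∃ b, Real.exp b = GKaplan n m γ z := ⟨_, Real.exp_log hNpos⟩
    have hb' : N = Real.exp b := hb.symm
    rw [hb', ← hb, ← ha, ← Real.exp_sub, ← Real.exp_mul, ← Real.exp_mul, ← Real.exp_mul,
      ← Real.exp_add, ← Real.exp_sub, ← Real.exp_mul, ← Real.exp_mul, ← Real.exp_add]
    congr 1
    rw [hq]
    field_simp
    ring
  have hpq : q.HolderConjugate p := by
    rw [Real.holderConjugate_iff]
    refine ⟨by linarith, ?_⟩
    rw [hq]
    field_simp
    ring
  have hy := Real.young_inequality_of_nonneg hΓ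
    (mul_nonneg hX0 (Real.rpow_nonneg (abs_nonneg (f z)) (q - 1))) hpq
  rw [Real.mul_rpow hX0 (by positivity), ← Real.rpow_mul (abs_nonneg _), hXp,
    show (q - 1) * p = q by rw [hqp]; field_simp] at hy
  calc q * |f z| ^ (q - 1) * D * θ = q * |f z| ^ (q - 1) * (D * θ) := by ring
    _ ≤ q * |f z| ^ (q - 1) * (gradNormG γ f z * X) := by gcongr
    _ = q * (gradNormG γ f z * (X * |f z| ^ (q - 1))) := by ring
    _ ≤ q * (gradNormG γ f z ^ q / q + θ * N ^ p * |f z| ^ q / p) := by gcongr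
    _ = _ := by rw [hqp]; field_simp

lemma continuous_gradNormG (hγ : 0 ≤ γ) {f : GrushinSpace n m → ℝ} (hf : ContDiff ℝ 1 f) :
    Continuous (gradNormG γ f) := by
  have h1 : Continuous (fderiv ℝ f) := hf.continuous_fderiv one_ne_zero
  unfold gradNormG gradSqG dX dY
  refine Continuous.sqrt (Continuous.add (by fun_prop) (Continuous.mul ?_ (by fun_prop)))
  exact Continuous.rpow_const (by fun_prop) fun _ => Or.inr (by positivity)

lemma hasCompactSupport_gradNormG {f : GrushinSpace n m → ℝ}
    (hfc : HasCompactSupport f) : HasCompactSupport (gradNormG γ f) := by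
  refine HasCompactSupport.mono' (hfc.fderiv ℝ) ?_
  refine fun z hz => subset_tsupport _ fun h => hz ?_
  simp [gradNormG, gradSqG, dX, dY, h]

/-- The unnormalised density `e^{-N^p}`. -/
noncomputable def densG (γ p : ℝ) (z : GrushinSpace n m) : ℝ := Real.exp (-(GKaplan n m γ z) ^ p)

lemma densG_pos (γ p : ℝ) (z : GrushinSpace n m) : 0 < densG γ p z := Real.exp_pos _

lemma continuous_densG (hγ : 0 ≤ γ) {p : ℝ} (hp : 0 ≤ p) :
    Continuous (densG γ p : GrushinSpace n m → ℝ) := by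
  have := (continuous_GKaplan (n := n) (m := m) hγ).rpow_const (p := p) fun _ => Or.inr hp
  unfold densG
  fun_prop

lemma HasCompactSupport.abs_rpow {X : Type*} [TopologicalSpace X] {f : X → ℝ}
    (hf : HasCompactSupport f) {q : ℝ} (hq : q ≠ 0) : HasCompactSupport fun z => |f z| ^ q :=
  hf.comp_left (g := fun t : ℝ => |t| ^ q) (by simp [Real.zero_rpow hq])

/-- A weighted `U`-bound: the degenerate potential `|∇_γ N^p|^q` is controlled by the energy. -/
lemma integral_angleG_mul_le {p q : ℝ} (hγ : 0 < γ) (hp : 2 ≤ p) (hq : q = p / (p - 1))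
    {f : GrushinSpace n m → ℝ} (hf : ContDiff ℝ 1 f) (hfc : HasCompactSupport f) :
    ∫ z, angleG γ q z * GKaplan n m γ z ^ p * |f z| ^ q * densG γ p z ≤
      (∫ z, gradNormG γ f z ^ q * densG γ p z) +
        (n + (1 + γ) * m) * ∫ z, |f z| ^ q * densG γ p z := by
  have hp1 : 0 < p - 1 := by linarith
  have hq1 : q - 1 = 1 / (p - 1) := by rw [hq]; field_simp; ring
  have hq1' : 1 < q := by
    have : 0 < q - 1 := by rw [hq1]; positivity
    linarith
  have hq2 : q - 1 ≤ 1 := by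
    rw [hq1, div_le_one hp1]; linarith
  have hNc := continuous_GKaplan (n := n) (m := m) hγ.le
  have hNpc : Continuous fun z : GrushinSpace n m => GKaplan n m γ z ^ p :=
    hNc.rpow_const fun _ => Or.inr (by linarith)
  have hdc := continuous_densG (n := n) (m := m) hγ.le (p := p) (by linarith)
  have hgc : Continuous fun z => |f z| ^ q :=
    hf.continuous.abs.rpow_const fun _ => Or.inr (by linarith)
  have hgs : HasCompactSupport fun z => |f z| ^ q := hfc.abs_rpow (by linarith)
  have hDc : Continuous fun z : GrushinSpace n m => fderiv ℝ f z (z.1, (1 + γ) • z.2) :=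
    (hf.continuous_fderiv one_ne_zero).clm_apply (by fun_prop)
  have hψc : Continuous fun t : ℝ => q * |t| ^ (q - 2) * t := by
    have h1 : ContDiff ℝ 1 fun t : ℝ => |t| ^ q := contDiff_norm_rpow (E := ℝ) hq1'
    have h2 := h1.continuous_deriv le_rfl
    convert h2 using 1
    ext t
    exact ((hasDerivAt_abs_rpow t hq1').deriv).symm
  set E : GrushinSpace n m → ℝ := fun z =>
    q * |f z| ^ (q - 2) * f z * fderiv ℝ f z (z.1, (1 + γ) • z.2) with hE
  have hEc : Continuous E := (hψc.comp hf.continuous).mul hDc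
  set G : GrushinSpace n m → ℝ := fun z => |f z| ^ q * densG γ p z with hG
  set H : GrushinSpace n m → ℝ := fun z =>
    (E z - p * GKaplan n m γ z ^ p * |f z| ^ q) * densG γ p z with hH
  have hGc : Continuous G := hgc.mul hdc
  have hGs : HasCompactSupport G := hgs.mul_right
  have hHc : Continuous H := (hEc.sub ((hNpc.const_mul p).mul hgc)).mul hdc
  have hHs : HasCompactSupport H := by
    refine hfc.mono fun z hz => ?_
    contrapose! hz
    have : f z = 0 := by simpa using hz
    simp [hH, hE, this, Real.zero_rpow (by linarith : q ≠ 0)]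
  have hd : ∀ z τ, HasDerivAt (fun τ => G (dilG γ τ z)) (H (dilG γ τ z)) τ := by
    intro z τ
    have h1 : HasDerivAt (fun τ => f (dilG γ τ z))
        (fderiv ℝ f (dilG γ τ z) ((dilG γ τ z).1, (1 + γ) • (dilG γ τ z).2)) τ :=
      (hf.differentiable one_ne_zero _).hasFDerivAt.comp_hasDerivAt τ (hasDerivAt_dilG γ τ z)
    have h2 := (hasDerivAt_abs_rpow (f (dilG γ τ z)) hq1').comp τ h1
    have h3 : (fun τ => densG γ p (dilG γ τ z)) =
        fun τ => Real.exp (-(Real.exp (τ * p) * GKaplan n m γ z ^ p)) := by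
      ext τ
      rw [densG, GKaplan_dilG hγ.le, Real.mul_rpow (Real.exp_pos _).le (GKaplan_nonneg hγ.le z),
        ← Real.exp_mul]
    have h4 : HasDerivAt (fun τ => densG γ p (dilG γ τ z))
        (-(p * GKaplan n m γ (dilG γ τ z) ^ p) * densG γ p (dilG γ τ z)) τ := by
      have h5 : HasDerivAt (fun τ => Real.exp (-(Real.exp (τ * p) * GKaplan n m γ z ^ p))) _ τ :=
        ((((hasDerivAt_id τ).mul_const p).exp.mul_const (GKaplan n m γ z ^ p)).neg).exp
      rw [← h3] at h5
      refine h5.congr_deriv ?_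
      have h6 := congrFun h3 τ
      rw [h6, GKaplan_dilG hγ.le, Real.mul_rpow (Real.exp_pos _).le (GKaplan_nonneg hγ.le z),
        ← Real.exp_mul]
      simp only [id, Pi.neg_apply]
      ring
    refine (h2.mul h4).congr_deriv ?_
    simp only [hH, hE, Function.comp]
    ring
  have key := integral_add_mul_eq_zero_of_hasDerivAt_dilG hγ.le hGc hGs hHc hHs hd
    (measurable_angleG hγ.le q) (fun z => by
      rw [abs_of_nonneg (angleG_nonneg hγ.le q z)]
      exact angleG_le_one hγ.le (by linarith) z) (angleG_dilG hγ.le q)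
  have hbdd : ∀ Ψ : GrushinSpace n m → ℝ, Integrable Ψ →
      Integrable fun z => angleG γ q z * Ψ z := fun Ψ hΨ =>
    hΨ.bdd_mul (c := 1) (measurable_angleG hγ.le q).aestronglyMeasurable
      (Filter.Eventually.of_forall fun z => by
        rw [Real.norm_of_nonneg (angleG_nonneg hγ.le q z)]
        exact angleG_le_one hγ.le (by linarith) z)
  have iG : Integrable G := hGc.integrable_of_hasCompactSupport hGs
  have iH : Integrable H := hHc.integrable_of_hasCompactSupport hHs
  have iV : Integrable fun z => angleG γ q z * GKaplan n m γ z ^ p * |f z| ^ q * densG γ p z := by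
    have := hbdd (fun z => GKaplan n m γ z ^ p * (|f z| ^ q * densG γ p z))
      ((hNpc.mul hGc).integrable_of_hasCompactSupport hGs.mul_left)
    refine this.congr (Filter.Eventually.of_forall fun z => ?_)
    simp only
    ring
  have iΓ : Integrable fun z => gradNormG γ f z ^ q * densG γ p z := by
    have h1 : Continuous fun z => gradNormG γ f z ^ q :=
      (continuous_gradNormG hγ.le hf).rpow_const fun _ => Or.inr (by linarith)
    refine (h1.mul hdc).integrable_of_hasCompactSupport (HasCompactSupport.mul_right ?_)
    exact (hasCompactSupport_gradNormG hfc).comp_left (g := fun t : ℝ => t ^ q)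
      (Real.zero_rpow (by linarith))
  have iL : Integrable fun z => (H z + (n + (1 + γ) * m) * G z) * angleG γ q z := by
    refine (hbdd _ (iH.add (iG.const_mul (n + (1 + γ) * m)))).congr
      (Filter.Eventually.of_forall fun z => ?_)
    simp only [Pi.add_apply]
    ring
  rw [← integral_const_mul, ← integral_add iΓ (iG.const_mul _)]
  have hsum : ∫ z, angleG γ q z * GKaplan n m γ z ^ p * |f z| ^ q * densG γ p z =
      ∫ z, (angleG γ q z * GKaplan n m γ z ^ p * |f z| ^ q * densG γ p z +
        (H z + (n + (1 + γ) * m) * G z) * angleG γ q z) := by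
    rw [integral_add iV iL, key, add_zero]
  rw [hsum]
  refine integral_mono (iV.add iL) (iΓ.add (iG.const_mul _)) fun z => ?_
  have hy := young_angleG hγ (by linarith) hq f z
  have hθ0 := angleG_nonneg hγ.le q z
  have hθ1 := angleG_le_one hγ.le (q := q) (by linarith) z
  have hN0 : 0 ≤ GKaplan n m γ z ^ p := Real.rpow_nonneg (GKaplan_nonneg hγ.le z) _
  have hf0 : 0 ≤ |f z| ^ q := by positivity
  have hE1 : E z ≤ q * |f z| ^ (q - 1) * |fderiv ℝ f z (z.1, (1 + γ) • z.2)| := by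
    refine (le_abs_self _).trans_eq ?_
    rw [hE]
    simp only [abs_mul]
    rw [abs_of_pos (by linarith : 0 < q), abs_of_nonneg (Real.rpow_nonneg (abs_nonneg _) _)]
    rcases eq_or_ne (f z) 0 with h | h
    · simp [h, Real.zero_rpow (by linarith : q - 1 ≠ 0)]
    · rw [mul_assoc q, ← Real.rpow_add_one (abs_ne_zero.2 h)]
      congr 3
      ring
  have hE2 : E z * angleG γ q z ≤ gradNormG γ f z ^ q +
      (q - 1) * (angleG γ q z * GKaplan n m γ z ^ p * |f z| ^ q) :=
    (mul_le_mul_of_nonneg_right hE1 hθ0).trans hy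
  have hV0 : 0 ≤ angleG γ q z * GKaplan n m γ z ^ p * |f z| ^ q := by positivity
  have hQ : 0 ≤ (n + (1 + γ) * m) * |f z| ^ q := by positivity
  have hw := densG_pos γ p z
  simp only [hH, hG]
  calc _ = (angleG γ q z * GKaplan n m γ z ^ p * |f z| ^ q + E z * angleG γ q z -
        p * (angleG γ q z * GKaplan n m γ z ^ p * |f z| ^ q) +
        (n + (1 + γ) * m) * |f z| ^ q * angleG γ q z) * densG γ p z := by ring
    _ ≤ (gradNormG γ f z ^ q + (n + (1 + γ) * m) * |f z| ^ q) * densG γ p z := by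
        refine mul_le_mul_of_nonneg_right ?_ hw.le
        have h1 := mul_nonneg hQ (sub_nonneg.2 hθ1)
        have h2 := mul_nonneg hV0 (by linarith : 0 ≤ p - q)
        linarith
    _ = _ := by ring

lemma lintegral_angleG_mul_le {p q : ℝ} (hγ : 0 < γ) (hp : 2 ≤ p) (hq : q = p / (p - 1))
    {f : GrushinSpace n m → ℝ} (hf : ContDiff ℝ 1 f) (hfc : HasCompactSupport f) :
    ∫⁻ z, ENNReal.ofReal (densG γ p z) *
        ENNReal.ofReal (angleG γ q z * GKaplan n m γ z ^ p * |f z| ^ q) ≤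
      (∫⁻ z, ENNReal.ofReal (densG γ p z) * ENNReal.ofReal (gradNormG γ f z ^ q)) +
        ENNReal.ofReal (n + (1 + γ) * m) *
          ∫⁻ z, ENNReal.ofReal (densG γ p z) * ENNReal.ofReal (|f z| ^ q) := by
  have hq1 : 1 < q := by
    rw [hq, lt_div_iff₀ (by linarith)]; linarith
  have hdc := continuous_densG (n := n) (m := m) hγ.le (p := p) (by linarith)
  have conv : ∀ Ψ : GrushinSpace n m → ℝ, (∀ z, 0 ≤ Ψ z) →
      Integrable (fun z => Ψ z * densG γ p z) →
      ∫⁻ z, ENNReal.ofReal (densG γ p z) * ENNReal.ofReal (Ψ z) =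
        ENNReal.ofReal (∫ z, Ψ z * densG γ p z) := by
    intro Ψ hΨ hi
    rw [ofReal_integral_eq_lintegral_ofReal hi
      (Filter.Eventually.of_forall fun z => mul_nonneg (hΨ z) (densG_pos γ p z).le)]
    refine lintegral_congr fun z => ?_
    rw [mul_comm, ENNReal.ofReal_mul (hΨ z)]
  have iG : Integrable fun z => |f z| ^ q * densG γ p z := by
    have : Continuous fun z => |f z| ^ q :=
      hf.continuous.abs.rpow_const fun _ => Or.inr (by linarith)
    exact (this.mul hdc).integrable_of_hasCompactSupport (hfc.abs_rpow (by linarith)).mul_right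
  have iΓ : Integrable fun z => gradNormG γ f z ^ q * densG γ p z := by
    have h1 : Continuous fun z => gradNormG γ f z ^ q :=
      (continuous_gradNormG hγ.le hf).rpow_const fun _ => Or.inr (by linarith)
    refine (h1.mul hdc).integrable_of_hasCompactSupport (HasCompactSupport.mul_right ?_)
    exact (hasCompactSupport_gradNormG hfc).comp_left (g := fun t : ℝ => t ^ q)
      (Real.zero_rpow (by linarith))
  have iV : Integrable fun z => angleG γ q z * GKaplan n m γ z ^ p * |f z| ^ q * densG γ p z := by
    have hNpc : Continuous fun z : GrushinSpace n m => GKaplan n m γ z ^ p :=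
      (continuous_GKaplan hγ.le).rpow_const fun _ => Or.inr (by linarith)
    have hc : Continuous fun z => |f z| ^ q * densG γ p z :=
      (hf.continuous.abs.rpow_const fun _ => Or.inr (by linarith)).mul hdc
    have h1 : Integrable fun z : GrushinSpace n m =>
        GKaplan n m γ z ^ p * (|f z| ^ q * densG γ p z) :=
      (hNpc.mul hc).integrable_of_hasCompactSupport
      (hfc.abs_rpow (by linarith : q ≠ 0)).mul_right.mul_left
    refine (h1.bdd_mul (c := 1) (measurable_angleG hγ.le q).aestronglyMeasurable
      (Filter.Eventually.of_forall fun z => ?_)).congr (Filter.Eventually.of_forall fun z => ?_)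
    · rw [Real.norm_of_nonneg (angleG_nonneg hγ.le q z)]
      exact angleG_le_one hγ.le (by linarith) z
    · simp only
      ring
  have hN0 : ∀ z : GrushinSpace n m, 0 ≤ GKaplan n m γ z ^ p := fun z =>
    Real.rpow_nonneg (GKaplan_nonneg hγ.le z) _
  rw [conv _
      (fun z => mul_nonneg (mul_nonneg (angleG_nonneg hγ.le q z) (hN0 z)) (by positivity)) iV,
    conv _ (fun z => Real.rpow_nonneg (gradNormG_nonneg γ f z) q) iΓ,
    conv _ (fun z => by positivity) iG, ← ENNReal.ofReal_mul (by positivity),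
    ← ENNReal.ofReal_add]
  · exact ENNReal.ofReal_le_ofReal (integral_angleG_mul_le hγ hp hq hf hfc)
  · exact integral_nonneg fun z =>
      mul_nonneg (Real.rpow_nonneg (gradNormG_nonneg γ f z) q) (densG_pos γ p z).le
  · exact mul_nonneg (by positivity) (integral_nonneg fun z =>
      mul_nonneg (by positivity) (densG_pos γ p z).le)

lemma rpow_mul_rpow_le_angleG_mul {p q : ℝ} (hγ : 0 ≤ γ) (hpq : 0 ≤ p - γ * q)
    (z : GrushinSpace n m) (hz : 0 < ‖z.1‖) {b : ℝ} (hb : 0 ≤ b) (hbN : b ≤ GKaplan n m γ z) :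
    ‖z.1‖ ^ (γ * q) * b ^ (p - γ * q) ≤ angleG γ q z * GKaplan n m γ z ^ p := by
  have hN : 0 < GKaplan n m γ z := hz.trans_le (norm_fst_le_GKaplan hγ z)
  unfold angleG
  rw [Real.div_rpow (norm_nonneg _) hN.le, div_mul_eq_mul_div, mul_div_assoc,
    ← Real.rpow_sub hN]
  gcongr

/-- The width exponent of the region around the degenerate axis `x = 0`. -/
noncomputable def axisExp (γ p : ℝ) : ℝ := (p - (1 + γ)) / (1 + γ) ^ 2

lemma axisExp_pos {p : ℝ} (hγ : 0 ≤ γ) (hp : 1 + γ < p) : 0 < axisExp γ p := by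
  unfold axisExp
  have : 0 < p - (1 + γ) := by linarith
  positivity

lemma norm_snd_rpow_le_angleG_mul {p q : ℝ} (hγ : 0 ≤ γ) (hp : 1 + γ < p) (hq : q = p / (p - 1))
    (z : GrushinSpace n m) (hy : 1 ≤ ‖z.2‖) (hx : ‖z.2‖ ^ (-axisExp γ p) ≤ ‖z.1‖) :
    ‖z.2‖ ^ (axisExp γ p * q) ≤ angleG γ q z * GKaplan n m γ z ^ p := by
  have hp1 : 0 < p - 1 := by linarith
  have hq0 : 0 ≤ q := by rw [hq]; exact div_nonneg (by linarith) hp1.le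
  have hy0 : 0 < ‖z.2‖ := by linarith
  have hpq : p - γ * q = (p - (1 + γ)) * q := by rw [hq]; field_simp; ring
  have hb : ‖z.2‖ ^ (1 / (1 + γ)) ≤ GKaplan n m γ z := by
    have h1 := norm_snd_le_GKaplan_rpow hγ z
    have h2 := Real.rpow_le_rpow hy0.le h1 (by positivity : 0 ≤ 1 / (1 + γ))
    rwa [← Real.rpow_mul (GKaplan_nonneg hγ z), mul_one_div_cancel (by linarith), Real.rpow_one]
      at h2
  have hx0 : 0 < ‖z.1‖ := lt_of_lt_of_le (by positivity) hx
  refine le_trans ?_ (rpow_mul_rpow_le_angleG_mul hγ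
    (by rw [hpq]; exact mul_nonneg (by linarith) hq0) z hx0 (by positivity) hb)
  calc ‖z.2‖ ^ (axisExp γ p * q)
      = (‖z.2‖ ^ (-axisExp γ p)) ^ (γ * q) * (‖z.2‖ ^ (1 / (1 + γ))) ^ (p - γ * q) := by
        rw [← Real.rpow_mul hy0.le, ← Real.rpow_mul hy0.le, ← Real.rpow_add hy0, hpq]
        congr 1
        unfold axisExp
        field_simp
        ring
    _ ≤ _ := by gcongr

lemma norm_fst_rpow_le_angleG_mul {p q : ℝ} (hγ : 0 ≤ γ) (hp : 1 + γ < p) (hq : q = p / (p - 1))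
    (z : GrushinSpace n m) (hx : 0 < ‖z.1‖) :
    ‖z.1‖ ^ p ≤ angleG γ q z * GKaplan n m γ z ^ p := by
  have hp1 : 0 < p - 1 := by linarith
  have hq0 : 0 ≤ q := by rw [hq]; exact div_nonneg (by linarith) hp1.le
  have hpq : p - γ * q = (p - (1 + γ)) * q := by rw [hq]; field_simp; ring
  have := rpow_mul_rpow_le_angleG_mul hγ
    (by rw [hpq]; exact mul_nonneg (by linarith) hq0) z hx hx.le (norm_fst_le_GKaplan hγ z)
  rwa [← Real.rpow_add hx, add_sub_cancel] at this

/-- Near the degenerate axis the density is essentially constant in `x`. -/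
lemma exists_densG_le_of_norm_fst_le {p : ℝ} (hγ : 0 ≤ γ) (hp : 1 + γ < p) :
    ∃ c : ℝ, 1 ≤ c ∧ ∀ (x x' : EuclideanSpace ℝ (Fin n)) (y : EuclideanSpace ℝ (Fin m)),
      1 ≤ ‖y‖ → ‖x'‖ ≤ 3 * ‖y‖ ^ (-axisExp γ p) →
        densG γ p (x, y) ≤ c * densG γ p (x', y) := by
  set a := p / (2 + 2 * γ) with ha
  have ha0 : 0 < a := by
    have : 0 < p := by linarith
    positivity
  set c₀ := ((1 + γ) ^ 2) ^ a * (3 : ℝ) ^ (2 * (1 + γ)) * (a * Real.exp (a * 3 ^ (2 * (1 + γ))))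
  have hc₀ : 0 ≤ c₀ := by positivity
  refine ⟨Real.exp c₀, Real.one_le_exp hc₀, fun x x' y hy hx' => ?_⟩
  unfold densG
  rw [← Real.exp_add]
  apply Real.exp_le_exp.2
  have hy0 : 0 < ‖y‖ := by linarith
  suffices GKaplan n m γ (x', y) ^ p ≤ GKaplan n m γ (x, y) ^ p + c₀ by linarith
  rw [GKaplan_rpow hγ, GKaplan_rpow hγ, ← ha]
  simp only
  set A := (1 + γ) ^ 2 * ‖y‖ ^ 2 with hA
  have hAy : ‖y‖ ^ 2 ≤ A := by
    rw [hA]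
    nlinarith [sq_nonneg ‖y‖, mul_nonneg hγ (sq_nonneg ‖y‖),
      mul_nonneg (sq_nonneg γ) (sq_nonneg ‖y‖)]
  have hA0 : 0 < A := by positivity
  set u := (3 * ‖y‖ ^ (-axisExp γ p)) ^ (2 * (1 + γ)) with hu
  have hu0 : 0 ≤ u := by positivity
  have hu' : u = 3 ^ (2 * (1 + γ)) * ‖y‖ ^ (-(2 * (p / (1 + γ) - 1))) := by
    rw [hu, Real.mul_rpow (by norm_num) (by positivity), ← Real.rpow_mul hy0.le]
    congr 2
    unfold axisExp
    field_simp
  have hv : u / A ≤ 3 ^ (2 * (1 + γ)) * ‖y‖ ^ (-(2 * (p / (1 + γ)))) := by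
    rw [div_le_iff₀ hA0]
    calc u = 3 ^ (2 * (1 + γ)) * ‖y‖ ^ (-(2 * (p / (1 + γ)))) * ‖y‖ ^ 2 := by
          rw [hu', mul_assoc, ← Real.rpow_natCast, ← Real.rpow_add hy0]
          congr 2
          push_cast
          ring
      _ ≤ _ := by gcongr
  have hpp : 0 ≤ p / (1 + γ) := div_nonneg (by linarith) (by linarith)
  have hv1 : u / A ≤ 3 ^ (2 * (1 + γ)) := by
    refine hv.trans (mul_le_of_le_one_right (by positivity) ?_)
    exact Real.rpow_le_one_of_one_le_of_nonpos hy (by linarith)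
  have hv0 : 0 ≤ u / A := by positivity
  have hAv : A ^ a * (u / A) ≤ ((1 + γ) ^ 2) ^ a * 3 ^ (2 * (1 + γ)) := by
    calc A ^ a * (u / A) ≤ A ^ a * (3 ^ (2 * (1 + γ)) * ‖y‖ ^ (-(2 * (p / (1 + γ))))) := by gcongr
      _ = ((1 + γ) ^ 2) ^ a * 3 ^ (2 * (1 + γ)) * ‖y‖ ^ (-(p / (1 + γ))) := by
        rw [hA, Real.mul_rpow (by positivity) (by positivity), ← Real.rpow_natCast ‖y‖,
          ← Real.rpow_mul hy0.le]
        have : ‖y‖ ^ (-(p / (1 + γ))) =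
            ‖y‖ ^ (((2 : ℕ) : ℝ) * a) * ‖y‖ ^ (-(2 * (p / (1 + γ)))) := by
          rw [← Real.rpow_add hy0]
          congr 1
          rw [ha]
          push_cast
          field_simp
          ring
        rw [this]
        ring
      _ ≤ _ := mul_le_of_le_one_right (by positivity)
        (Real.rpow_le_one_of_one_le_of_nonpos hy (by linarith))
  have hexp : (1 + u / A) ^ a ≤ 1 + a * (u / A) * Real.exp (a * 3 ^ (2 * (1 + γ))) := by
    have h1 : (1 + u / A) ^ a ≤ Real.exp (a * (u / A)) := by
      rw [mul_comm, Real.exp_mul]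
      gcongr
      linarith [Real.add_one_le_exp (u / A)]
    have h2 := Real.add_one_le_exp (-(a * (u / A)))
    have h3 : Real.exp (a * (u / A)) ≤ 1 + a * (u / A) * Real.exp (a * (u / A)) := by
      have h4 := mul_le_mul_of_nonneg_right h2 (Real.exp_pos (a * (u / A))).le
      rw [← Real.exp_add, neg_add_cancel, Real.exp_zero] at h4
      linarith
    refine h1.trans (h3.trans ?_)
    gcongr
  calc (‖x'‖ ^ (2 * (1 + γ)) + A) ^ a ≤ (u + A) ^ a := by
        have : ‖x'‖ ^ (2 * (1 + γ)) ≤ u := by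
          rw [hu]
          gcongr
        gcongr
    _ = A ^ a * (1 + u / A) ^ a := by
        rw [← Real.mul_rpow hA0.le (by positivity)]
        congr 1
        field_simp
        ring
    _ ≤ A ^ a * (1 + a * (u / A) * Real.exp (a * 3 ^ (2 * (1 + γ)))) := by gcongr
    _ = A ^ a + A ^ a * (u / A) * (a * Real.exp (a * 3 ^ (2 * (1 + γ)))) := by ring
    _ ≤ A ^ a + c₀ := add_le_add_right (mul_le_mul_of_nonneg_right hAv (by positivity)) _
    _ ≤ (‖x‖ ^ (2 * (1 + γ)) + A) ^ a + c₀ := by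
        gcongr
        have : 0 ≤ ‖x‖ ^ (2 * (1 + γ)) := by positivity
        linarith

lemma lintegral_translate_fst_sub_le {q : ℝ} (hq : 1 ≤ q) {f : GrushinSpace n m → ℝ}
    (hf : ContDiff ℝ 1 f) {g : EuclideanSpace ℝ (Fin m) → EuclideanSpace ℝ (Fin n)}
    (hg : Measurable g) {w w' : GrushinSpace n m → ℝ≥0∞} (hw' : Measurable w')
    (hw : ∀ z, ∀ t ∈ Set.Ioc (0 : ℝ) 1, w z ≤ w' (z.1 + t • g z.2, z.2)) :
    ∫⁻ z, w z * ENNReal.ofReal (|f (z.1 + g z.2, z.2) - f z| ^ q) ≤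
      ∫⁻ z, w' z * ENNReal.ofReal ((gradNormG γ f z * ‖g z.2‖) ^ q) := by
  have hF : Continuous fun a : GrushinSpace n m × EuclideanSpace ℝ (Fin n) =>
      fderiv ℝ f a.1 (a.2, 0) := by
    have := hf.continuous_fderiv (by norm_num)
    fun_prop
  have key := lintegral_flow_sub_le (volume : Measure (GrushinSpace n m))
    (fun t z => (z.1 + t • g z.2, z.2)) (by fun_prop)
    (fun t => by simpa using measurePreserving_shear (n := n) (hg.const_smul t) 0)
    (fun z => by simp) f (fun z => fderiv ℝ f z (g z.2, 0))
    (hF.measurable.comp (g := fun a : GrushinSpace n m × EuclideanSpace ℝ (Fin n) =>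
      fderiv ℝ f a.1 (a.2, 0)) (f := fun z => (z, g z.2)) (by fun_prop))
    (fun z t => by
      have h1 : HasDerivAt (fun t : ℝ => ((z.1 + t • g z.2, z.2) : GrushinSpace n m))
          (g z.2, 0) t := by
        refine HasDerivAt.prodMk ?_ (hasDerivAt_const _ _)
        simpa using ((hasDerivAt_id t).smul_const (g z.2)).const_add z.1
      exact ((hf.differentiable (by norm_num)) _).hasFDerivAt.comp_hasDerivAt t h1)
    (fun z => by
      have := hf.continuous_fderiv (by norm_num)
      simp only
      fun_prop) hq w w' hw' hw
  simp only [one_smul] at key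
  refine key.trans (lintegral_mono fun z => ?_)
  gcongr
  exact abs_fderiv_fst_le_gradNormG γ f z _

lemma lintegral_translate_snd_sub_le {q : ℝ} (hq : 1 ≤ q) {f : GrushinSpace n m → ℝ}
    (hf : ContDiff ℝ 1 f) (k : EuclideanSpace ℝ (Fin m)) {w w' : GrushinSpace n m → ℝ≥0∞}
    (hw' : Measurable w') (hw : ∀ z, ∀ t ∈ Set.Ioc (0 : ℝ) 1, w z ≤ w' (z.1, z.2 + t • k)) :
    ∫⁻ z, w z * ENNReal.ofReal (|f (z.1, z.2 + k) - f z| ^ q) ≤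
      ∫⁻ z, w' z * ENNReal.ofReal (|fderiv ℝ f z (0, k)| ^ q) := by
  have hF := hf.continuous_fderiv (by norm_num)
  have key := lintegral_flow_sub_le (volume : Measure (GrushinSpace n m))
    (fun t z => (z.1, z.2 + t • k)) (by fun_prop)
    (fun t => by simpa using measurePreserving_shear (n := n) (measurable_const (a := 0)) (t • k))
    (fun z => by simp) f (fun z => fderiv ℝ f z (0, k))
    (by fun_prop)
    (fun z t => by
      have h1 : HasDerivAt (fun t : ℝ => ((z.1, z.2 + t • k) : GrushinSpace n m)) (0, k) t := by
        refine HasDerivAt.prodMk (hasDerivAt_const _ _) ?_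
        simpa using ((hasDerivAt_id t).smul_const k).const_add z.2
      exact ((hf.differentiable (by norm_num)) _).hasFDerivAt.comp_hasDerivAt t h1)
    (fun z => by fun_prop) hq w w' hw' hw
  simpa only [one_smul] using key

lemma abs_rpow_le_two_mul_add {q : ℝ} (hq : 1 ≤ q) (hq2 : q ≤ 2) (a b : ℝ) :
    ENNReal.ofReal (|a| ^ q) ≤
      2 * (ENNReal.ofReal (|b| ^ q) + ENNReal.ofReal (|b - a| ^ q)) := by
  have hq0 : 0 ≤ q := by linarith
  have h1 : ENNReal.ofReal |a| ≤ ENNReal.ofReal |b| + ENNReal.ofReal |b - a| := by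
    rw [← ENNReal.ofReal_add (abs_nonneg _) (abs_nonneg _)]
    apply ENNReal.ofReal_le_ofReal
    have := abs_sub_abs_le_abs_sub a b
    rw [abs_sub_comm] at this
    linarith
  rw [← ENNReal.ofReal_rpow_of_nonneg (abs_nonneg _) hq0,
    ← ENNReal.ofReal_rpow_of_nonneg (abs_nonneg _) hq0,
    ← ENNReal.ofReal_rpow_of_nonneg (abs_nonneg _) hq0]
  refine (ENNReal.rpow_le_rpow h1 hq0).trans
    ((ENNReal.rpow_add_le_mul_rpow_add_rpow _ _ hq).trans ?_)
  gcongr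
  calc (2 : ℝ≥0∞) ^ (q - 1) ≤ 2 ^ (1 : ℝ) :=
        ENNReal.rpow_le_rpow_of_exponent_le (by norm_num) (by linarith)
    _ = 2 := by simp

lemma exists_norm_eq_one (hn : 1 ≤ n) : ∃ e : EuclideanSpace ℝ (Fin n), ‖e‖ = 1 :=
  ⟨EuclideanSpace.single ⟨0, hn⟩ 1, by simp⟩

/-- The mass near the degenerate axis is controlled by translating off the axis. -/
lemma exists_lintegral_axis_le (hn : 1 ≤ n) {p q : ℝ} (hγ : 0 ≤ γ) (hp : 1 + γ < p) (hq : 1 ≤ q)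
    (hq2 : q ≤ 2) :
    ∃ c : ℝ, 0 ≤ c ∧ ∀ Y : ℝ, 1 ≤ Y → ∀ f : GrushinSpace n m → ℝ, ContDiff ℝ 1 f →
      ∫⁻ z in {z : GrushinSpace n m | Y ≤ ‖z.2‖ ∧ ‖z.1‖ < ‖z.2‖ ^ (-axisExp γ p)},
          ENNReal.ofReal (densG γ p z) * ENNReal.ofReal (|f z| ^ q) ≤
        ENNReal.ofReal c *
          ((∫⁻ z in {z : GrushinSpace n m | Y ≤ ‖z.2‖ ∧ ‖z.2‖ ^ (-axisExp γ p) ≤ ‖z.1‖},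
              ENNReal.ofReal (densG γ p z) * ENNReal.ofReal (|f z| ^ q)) +
            ENNReal.ofReal (Y ^ (-(axisExp γ p * q))) *
              ∫⁻ z, ENNReal.ofReal (densG γ p z) * ENNReal.ofReal (gradNormG γ f z ^ q)) := by
  obtain ⟨c, hc1, hc⟩ := exists_densG_le_of_norm_fst_le (n := n) (m := m) hγ hp
  obtain ⟨e, he⟩ := exists_norm_eq_one hn
  refine ⟨8 * c, by linarith, fun Y hY f hf => ?_⟩
  have hσ := axisExp_pos hγ hp
  set σ := axisExp γ p
  set S : Set (GrushinSpace n m) := {z | Y ≤ ‖z.2‖ ∧ ‖z.1‖ < ‖z.2‖ ^ (-σ)} with hS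
  set T : Set (GrushinSpace n m) := {z | Y ≤ ‖z.2‖ ∧ ‖z.2‖ ^ (-σ) ≤ ‖z.1‖} with hT
  set S' : Set (GrushinSpace n m) := {z | Y ≤ ‖z.2‖ ∧ ‖z.1‖ ≤ 3 * ‖z.2‖ ^ (-σ)} with hS'
  have hSm : MeasurableSet S := by
    rw [hS, Set.ofPred_and]
    exact (measurableSet_le (by fun_prop) (by fun_prop)).inter
      (measurableSet_lt (by fun_prop) (by fun_prop))
  have hTm : MeasurableSet T := by
    rw [hT, Set.ofPred_and]
    exact (measurableSet_le (by fun_prop) (by fun_prop)).inter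
      (measurableSet_le (by fun_prop) (by fun_prop))
  have hSm' : MeasurableSet S' := by
    rw [hS', Set.ofPred_and]
    exact (measurableSet_le (by fun_prop) (by fun_prop)).inter
      (measurableSet_le (by fun_prop) (by fun_prop))
  have hdm : Measurable fun z : GrushinSpace n m => ENNReal.ofReal (densG γ p z) :=
    (continuous_densG hγ (by linarith)).measurable.ennreal_ofReal
  set g : EuclideanSpace ℝ (Fin m) → EuclideanSpace ℝ (Fin n) := fun y => (2 * ‖y‖ ^ (-σ)) • e
  have hgm : Measurable g := by fun_prop
  have hgn : ∀ y, ‖g y‖ = 2 * ‖y‖ ^ (-σ) := fun y => by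
    rw [norm_smul, he, mul_one, Real.norm_of_nonneg (by positivity)]
  set w := S.indicator fun z => ENNReal.ofReal (densG γ p z) with hw
  set w' := S'.indicator fun z => ENNReal.ofReal c * ENNReal.ofReal (densG γ p z) with hw'
  set w'' := T.indicator fun z => ENNReal.ofReal c * ENNReal.ofReal (densG γ p z) with hw''
  have hdens : ∀ z ∈ S, ∀ x' : EuclideanSpace ℝ (Fin n), ‖x'‖ ≤ 3 * ‖z.2‖ ^ (-σ) →
      ENNReal.ofReal (densG γ p z) ≤ ENNReal.ofReal c * ENNReal.ofReal (densG γ p (x', z.2)) := by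
    intro z hz x' hx'
    rw [← ENNReal.ofReal_mul (by linarith)]
    exact ENNReal.ofReal_le_ofReal (hc z.1 x' z.2 (hY.trans hz.1) hx')
  have hup : ∀ z ∈ S, ∀ t ∈ Set.Ioc (0 : ℝ) 1, ‖z.1 + t • g z.2‖ ≤ 3 * ‖z.2‖ ^ (-σ) := by
    intro z hz t ht
    refine (norm_add_le _ _).trans ?_
    rw [norm_smul, hgn, Real.norm_of_nonneg ht.1.le]
    have h1 : t * (2 * ‖z.2‖ ^ (-σ)) ≤ 1 * (2 * ‖z.2‖ ^ (-σ)) :=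
      mul_le_mul_of_nonneg_right ht.2 (by positivity)
    linarith [hz.2]
  have hww' : ∀ z, ∀ t ∈ Set.Ioc (0 : ℝ) 1, w z ≤ w' (z.1 + t • g z.2, z.2) := by
    intro z t ht
    by_cases hz : z ∈ S
    · have : ((z.1 + t • g z.2, z.2) : GrushinSpace n m) ∈ S' := ⟨hz.1, hup z hz t ht⟩
      rw [hw, hw', Set.indicator_of_mem hz, Set.indicator_of_mem this]
      exact hdens z hz _ (hup z hz t ht)
    · rw [hw, Set.indicator_of_notMem hz]
      exact zero_le
  have hww'' : ∀ z, w z ≤ w'' (z.1 + g z.2, z.2) := by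
    intro z
    by_cases hz : z ∈ S
    · have hup1 : ‖z.1 + g z.2‖ ≤ 3 * ‖z.2‖ ^ (-σ) := by
        simpa using hup z hz 1 (by simp)
      have : ((z.1 + g z.2, z.2) : GrushinSpace n m) ∈ T := by
        refine ⟨hz.1, ?_⟩
        have h1 := norm_sub_norm_le (g z.2) (-z.1)
        rw [norm_neg, hgn, sub_neg_eq_add, add_comm (g z.2)] at h1
        have := hz.2
        simp only
        linarith
      rw [hw, hw'', Set.indicator_of_mem hz, Set.indicator_of_mem this]
      exact hdens z hz _ hup1
    · rw [hw, Set.indicator_of_notMem hz]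
      exact zero_le
  have hfm : Measurable fun z => ENNReal.ofReal (|f z| ^ q) := by
    have := hf.continuous.measurable
    fun_prop
  have hwm' : Measurable w' := (hdm.const_mul _).indicator hSm'
  have hwm'' : Measurable w'' := (hdm.const_mul _).indicator hTm
  have hwm : Measurable w := hdm.indicator hSm
  have hA : ∫⁻ z, w z * ENNReal.ofReal (|f (z.1 + g z.2, z.2)| ^ q) ≤
      ENNReal.ofReal c * ∫⁻ z in T, ENNReal.ofReal (densG γ p z) * ENNReal.ofReal (|f z| ^ q) := by
    calc ∫⁻ z, w z * ENNReal.ofReal (|f (z.1 + g z.2, z.2)| ^ q)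
        ≤ ∫⁻ z : GrushinSpace n m,
            w'' (z.1 + g z.2, z.2) * ENNReal.ofReal (|f (z.1 + g z.2, z.2)| ^ q) :=
          lintegral_mono fun z => mul_le_mul_left (hww'' z) _
      _ = ∫⁻ z, w'' z * ENNReal.ofReal (|f z| ^ q) := by
          have hmp : MeasurePreserving (fun z : GrushinSpace n m => (z.1 + g z.2, z.2)) := by
            simpa using measurePreserving_shear (n := n) hgm 0
          exact hmp.lintegral_comp (hwm''.mul hfm)
      _ = _ := by
          rw [← lintegral_indicator hTm, ← lintegral_const_mul' _ _ ENNReal.ofReal_ne_top]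
          refine lintegral_congr fun z => ?_
          by_cases hz : z ∈ T
          · simp only [hw'', Set.indicator_of_mem hz, mul_assoc]
          · simp only [hw'', Set.indicator_of_notMem hz, zero_mul, mul_zero]
  have hB : ∫⁻ z, w z * ENNReal.ofReal (|f (z.1 + g z.2, z.2) - f z| ^ q) ≤
      ENNReal.ofReal (4 * c) * (ENNReal.ofReal (Y ^ (-(σ * q))) *
        ∫⁻ z, ENNReal.ofReal (densG γ p z) * ENNReal.ofReal (gradNormG γ f z ^ q)) := by
    refine (lintegral_translate_fst_sub_le (γ := γ) hq hf hgm hwm' hww').trans ?_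
    rw [← mul_assoc, ← ENNReal.ofReal_mul (by linarith),
      ← lintegral_const_mul' _ _ ENNReal.ofReal_ne_top]
    refine lintegral_mono fun z => ?_
    by_cases hz : z ∈ S'
    · rw [hw', Set.indicator_of_mem hz, hgn, ← ENNReal.ofReal_mul (by linarith),
        ← ENNReal.ofReal_mul (mul_nonneg (by linarith) (densG_pos γ p z).le),
        ← ENNReal.ofReal_mul (densG_pos γ p z).le,
        ← ENNReal.ofReal_mul (mul_nonneg (by linarith) (by positivity))]
      apply ENNReal.ofReal_le_ofReal
      have hy : 0 < ‖z.2‖ := by linarith [hz.1]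
      have hΓ := gradNormG_nonneg γ f z
      rw [Real.mul_rpow hΓ (by positivity), Real.mul_rpow (by norm_num) (by positivity),
        ← Real.rpow_mul hy.le]
      have h2 : (2 : ℝ) ^ q ≤ 4 := by
        calc (2 : ℝ) ^ q ≤ 2 ^ (2 : ℝ) := Real.rpow_le_rpow_of_exponent_le (by norm_num) hq2
          _ = 4 := by norm_num
      have h3 : ‖z.2‖ ^ (-σ * q) ≤ Y ^ (-(σ * q)) := by
        rw [neg_mul]
        exact Real.rpow_le_rpow_of_nonpos (by linarith) hz.1 (by nlinarith)
      have hd := (densG_pos γ p z).le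
      calc c * densG γ p z * (gradNormG γ f z ^ q * (2 ^ q * ‖z.2‖ ^ (-σ * q)))
          ≤ c * densG γ p z * (gradNormG γ f z ^ q * (4 * Y ^ (-(σ * q)))) := by gcongr
        _ = _ := by ring
    · rw [hw', Set.indicator_of_notMem hz, zero_mul]
      exact zero_le
  calc ∫⁻ z in S, ENNReal.ofReal (densG γ p z) * ENNReal.ofReal (|f z| ^ q)
      = ∫⁻ z, w z * ENNReal.ofReal (|f z| ^ q) := by
        rw [← lintegral_indicator hSm]
        refine lintegral_congr fun z => ?_
        by_cases hz : z ∈ S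
        · simp only [hw, Set.indicator_of_mem hz]
        · simp only [hw, Set.indicator_of_notMem hz, zero_mul]
    _ ≤ ∫⁻ z, 2 * (w z * ENNReal.ofReal (|f (z.1 + g z.2, z.2)| ^ q) +
          w z * ENNReal.ofReal (|f (z.1 + g z.2, z.2) - f z| ^ q)) := by
        refine lintegral_mono fun z => ?_
        rw [← mul_add, mul_left_comm]
        exact mul_le_mul_right (abs_rpow_le_two_mul_add hq hq2 _ _) _
    _ = 2 * ((∫⁻ z, w z * ENNReal.ofReal (|f (z.1 + g z.2, z.2)| ^ q)) +
          ∫⁻ z, w z * ENNReal.ofReal (|f (z.1 + g z.2, z.2) - f z| ^ q)) := by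
        have := hf.continuous.measurable
        rw [lintegral_const_mul' _ _ (by norm_num), lintegral_add_left (by fun_prop)]
    _ ≤ 2 * (ENNReal.ofReal (4 * c) *
          (∫⁻ z in T, ENNReal.ofReal (densG γ p z) * ENNReal.ofReal (|f z| ^ q)) +
          ENNReal.ofReal (4 * c) * (ENNReal.ofReal (Y ^ (-(σ * q))) *
            ∫⁻ z, ENNReal.ofReal (densG γ p z) * ENNReal.ofReal (gradNormG γ f z ^ q))) := by
        gcongr
        refine hA.trans ?_
        gcongr
        linarith
    _ = _ := by
        rw [← mul_add, ← mul_assoc]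
        congr 1
        rw [← ENNReal.ofReal_ofNat 2, ← ENNReal.ofReal_mul (by norm_num)]
        congr 1
        ring

/-- The mass outside the box `‖x‖ ≤ R`, `‖y‖ ≤ R ^ (1 + γ)`. -/
lemma exists_lintegral_compl_le (hn : 1 ≤ n) {p q : ℝ} (hγ : 0 ≤ γ) (hp : 1 + γ < p) (hp2 : 2 ≤ p)
    (hq : q = p / (p - 1)) :
    ∃ c : ℝ, 0 ≤ c ∧ ∀ R : ℝ, 1 ≤ R → ∀ f : GrushinSpace n m → ℝ, ContDiff ℝ 1 f →
      ∫⁻ z in {z : GrushinSpace n m | ‖z.1‖ ≤ R ∧ ‖z.2‖ ≤ R ^ (1 + γ)}ᶜ,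
          ENNReal.ofReal (densG γ p z) * ENNReal.ofReal (|f z| ^ q) ≤
        ENNReal.ofReal (c * R ^ (-((1 + γ) * (axisExp γ p * q)))) *
          ((∫⁻ z, ENNReal.ofReal (densG γ p z) * ENNReal.ofReal (gradNormG γ f z ^ q)) +
            ∫⁻ z, ENNReal.ofReal (densG γ p z) *
              ENNReal.ofReal (angleG γ q z * GKaplan n m γ z ^ p * |f z| ^ q)) := by
  have hp1 : 0 < p - 1 := by linarith
  have hq1 : 1 ≤ q := by rw [hq, le_div_iff₀ hp1]; linarith
  have hq2 : q ≤ 2 := by rw [hq, div_le_iff₀ hp1]; linarith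
  have hσ := axisExp_pos hγ hp
  obtain ⟨c, hc0, hc⟩ := exists_lintegral_axis_le (m := m) hn hγ hp hq1 hq2
  refine ⟨c + 1, by linarith, fun R hR f hf => ?_⟩
  have hR0 : 0 < R := by linarith
  set s := (1 + γ) * (axisExp γ p * q) with hs
  have hsp : s ≤ p := by
    rw [hs, hq]
    unfold axisExp
    have h1 : (1 + γ) * ((p - (1 + γ)) / (1 + γ) ^ 2 * (p / (p - 1))) =
        (p - (1 + γ)) / ((1 + γ) * (p - 1)) * p := by
      field_simp
    rw [h1]
    refine mul_le_of_le_one_left (by linarith) ?_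
    rw [div_le_one (by positivity)]
    nlinarith
  set S : Set (GrushinSpace n m) :=
    {z | R ^ (1 + γ) ≤ ‖z.2‖ ∧ ‖z.1‖ < ‖z.2‖ ^ (-axisExp γ p)}
  set T : Set (GrushinSpace n m) :=
    {z | R ^ (1 + γ) ≤ ‖z.2‖ ∧ ‖z.2‖ ^ (-axisExp γ p) ≤ ‖z.1‖}
  set E : Set (GrushinSpace n m) := {z | R ^ s ≤ angleG γ q z * GKaplan n m γ z ^ p} with hE
  set VV := ∫⁻ z : GrushinSpace n m, ENNReal.ofReal (densG γ p z) *
    ENNReal.ofReal (angleG γ q z * GKaplan n m γ z ^ p * |f z| ^ q)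
  set G := ∫⁻ z, ENNReal.ofReal (densG γ p z) * ENNReal.ofReal (gradNormG γ f z ^ q)
  have hY : 1 ≤ R ^ (1 + γ) := Real.one_le_rpow hR (by linarith)
  have hTE : T ⊆ E := by
    intro z hz
    refine le_trans ?_ (norm_snd_rpow_le_angleG_mul hγ hp hq z (hY.trans hz.1) hz.2)
    rw [hs, Real.rpow_mul hR0.le]
    exact Real.rpow_le_rpow (by linarith) hz.1 (by positivity)
  have hUE : {z : GrushinSpace n m | R < ‖z.1‖} ⊆ E := by
    intro z hz
    refine le_trans ?_ (norm_fst_rpow_le_angleG_mul hγ hp hq z (hR0.trans hz))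
    calc R ^ s ≤ R ^ p := Real.rpow_le_rpow_of_exponent_le hR hsp
      _ ≤ _ := Real.rpow_le_rpow hR0.le (le_of_lt hz) (by linarith)
  have hKc : {z : GrushinSpace n m | ‖z.1‖ ≤ R ∧ ‖z.2‖ ≤ R ^ (1 + γ)}ᶜ ⊆ S ∪ E := by
    intro z hz
    by_cases hx : R < ‖z.1‖
    · exact Or.inr (hUE hx)
    · have hy : R ^ (1 + γ) ≤ ‖z.2‖ := by
        by_contra hy
        exact hz ⟨not_lt.1 hx, (not_le.1 hy).le⟩
      rcases lt_or_ge ‖z.1‖ (‖z.2‖ ^ (-axisExp γ p)) with h | h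
      · exact Or.inl ⟨hy, h⟩
      · exact Or.inr (hTE ⟨hy, h⟩)
  have hEm : MeasurableSet E := by
    have h1 := measurable_angleG (n := n) (m := m) hγ q
    have h2 := (continuous_GKaplan (n := n) (m := m) hγ).measurable
    exact measurableSet_le (by fun_prop) (by fun_prop)
  have hEV : ∫⁻ z in E, ENNReal.ofReal (densG γ p z) * ENNReal.ofReal (|f z| ^ q) ≤
      ENNReal.ofReal (R ^ (-s)) * VV := by
    rw [← lintegral_const_mul' _ _ ENNReal.ofReal_ne_top]
    refine (setLIntegral_mono' hEm fun z hz => ?_).trans (setLIntegral_le_lintegral E _)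
    rw [mul_left_comm, ← ENNReal.ofReal_mul (p := R ^ (-s)) (by positivity)]
    refine mul_le_mul_right (ENNReal.ofReal_le_ofReal ?_) _
    rw [← mul_assoc]
    refine le_mul_of_one_le_left (by positivity) ?_
    rw [Real.rpow_neg hR0.le, inv_mul_eq_div, one_le_div (by positivity)]
    exact hz
  have hRs : (R ^ (1 + γ)) ^ (-(axisExp γ p * q)) = R ^ (-s) := by
    rw [← Real.rpow_mul hR0.le, hs, mul_neg]
  have hSc := hc (R ^ (1 + γ)) hY f hf
  rw [hRs] at hSc
  calc _ ≤ ∫⁻ z in S ∪ E, ENNReal.ofReal (densG γ p z) * ENNReal.ofReal (|f z| ^ q) :=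
        lintegral_mono_set hKc
    _ ≤ _ := lintegral_union_le _ _ _
    _ ≤ ENNReal.ofReal c * (ENNReal.ofReal (R ^ (-s)) * VV + ENNReal.ofReal (R ^ (-s)) * G) +
          (ENNReal.ofReal (R ^ (-s)) * G + ENNReal.ofReal (R ^ (-s)) * VV) := by
        refine add_le_add (hSc.trans ?_) (hEV.trans le_add_self)
        gcongr
        exact (lintegral_mono_set hTE).trans hEV
    _ = _ := by
        rw [ENNReal.ofReal_mul (by linarith), ENNReal.ofReal_add hc0 (by norm_num),
          ENNReal.ofReal_one]
        ring

lemma ofReal_abs_rpow_half_sq (q t : ℝ) :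
    ENNReal.ofReal (|t| ^ (q / 2)) ^ 2 = ENNReal.ofReal (|t| ^ q) := by
  rw [← ENNReal.ofReal_pow (by positivity), ← Real.rpow_mul_natCast (abs_nonneg t)]
  simp

lemma ofReal_abs_rpow_le_add {r : ℝ} (hr : 0 ≤ r) (hr1 : r ≤ 1) (a b c : ℝ) :
    ENNReal.ofReal (|a| ^ r) ≤ ENNReal.ofReal (|b - a| ^ r) + ENNReal.ofReal (|c - b| ^ r) +
      ENNReal.ofReal (|c| ^ r) := by
  rw [← ENNReal.ofReal_add (by positivity) (by positivity),
    ← ENNReal.ofReal_add (by positivity) (by positivity)]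
  apply ENNReal.ofReal_le_ofReal
  have h1 : |a| ≤ |b - a| + |c - b| + |c| := by
    rw [abs_sub_comm b a, abs_sub_comm c b]
    calc |a| = |a - b + (b - c) + c| := by ring_nf
      _ ≤ _ := abs_add_three _ _ _
  calc |a| ^ r ≤ (|b - a| + |c - b| + |c|) ^ r := Real.rpow_le_rpow (abs_nonneg _) h1 hr
    _ ≤ (|b - a| + |c - b|) ^ r + |c| ^ r :=
      Real.rpow_add_le_add_rpow (by positivity) (by positivity) hr hr1
    _ ≤ _ := by
      gcongr
      exact Real.rpow_add_le_add_rpow (by positivity) (by positivity) hr hr1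

lemma ENNReal.add_sq_le_two_mul (a b : ℝ≥0∞) : (a + b) ^ 2 ≤ 2 * a ^ 2 + 2 * b ^ 2 := by
  have h := ENNReal.rpow_add_le_mul_rpow_add_rpow a b one_le_two
  norm_num at h
  rwa [mul_add] at h

lemma ENNReal.sq_lintegral_le {α : Type*} [MeasurableSpace α] (β : Measure α) {g : α → ℝ≥0∞}
    (hg : Measurable g) : (∫⁻ w, g w ∂β) ^ 2 ≤ β Set.univ * ∫⁻ w, g w ^ 2 ∂β := by
  have h := ENNReal.lintegral_mul_le_Lp_mul_Lq β Real.HolderConjugate.two_two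
    (f := fun _ => 1) aemeasurable_const hg.aemeasurable
  simp only [Pi.mul_apply, one_mul, ENNReal.rpow_two, one_pow, lintegral_one] at h
  calc (∫⁻ w, g w ∂β) ^ 2
      ≤ (β Set.univ ^ (1 / 2 : ℝ) * (∫⁻ w, g w ^ 2 ∂β) ^ (1 / 2 : ℝ)) ^ 2 :=
        pow_le_pow_left' h 2
    _ = _ := by
      rw [mul_pow, ← ENNReal.rpow_mul_natCast, ← ENNReal.rpow_mul_natCast]
      norm_num

/-- Averaging `c ≤ A + B + J` and squaring. -/
lemma ENNReal.sq_mul_sq_le_of_le_add {α : Type*} [MeasurableSpace α] (β : Measure α) (c : ℝ≥0∞)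
    {A B J : α → ℝ≥0∞} (hA : Measurable A) (hB : Measurable B)
    (h : ∀ᵐ w ∂β, c ≤ A w + B w + J w) :
    β Set.univ ^ 2 * c ^ 2 ≤
      4 * β Set.univ * (∫⁻ w, (A w ^ 2 + B w ^ 2) ∂β) + 2 * (∫⁻ w, J w ∂β) ^ 2 := by
  have h1 : β Set.univ * c ≤ (∫⁻ w, (A w + B w) ∂β) + ∫⁻ w, J w ∂β := by
    rw [← lintegral_add_left (f := fun w => A w + B w) (hA.add hB), mul_comm, ← lintegral_const]
    exact lintegral_mono_ae h
  calc β Set.univ ^ 2 * c ^ 2 = (β Set.univ * c) ^ 2 := by ring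
    _ ≤ ((∫⁻ w, (A w + B w) ∂β) + ∫⁻ w, J w ∂β) ^ 2 := by gcongr
    _ ≤ 2 * (∫⁻ w, (A w + B w) ∂β) ^ 2 + 2 * (∫⁻ w, J w ∂β) ^ 2 := ENNReal.add_sq_le_two_mul _ _
    _ ≤ 2 * (β Set.univ * ∫⁻ w, 2 * (A w ^ 2 + B w ^ 2) ∂β) + 2 * (∫⁻ w, J w ∂β) ^ 2 := by
        gcongr
        refine (ENNReal.sq_lintegral_le β (hA.add hB)).trans ?_
        gcongr with w
        rw [mul_add]
        exact ENNReal.add_sq_le_two_mul _ _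
    _ = _ := by
        rw [lintegral_const_mul' _ _ (by norm_num)]
        ring

/-- The box of size `R` adapted to the Grushin dilations, enlarged by the factor `l`. -/
def boxG (n m : ℕ) (γ l R : ℝ) : Set (GrushinSpace n m) :=
  {z | ‖z.1‖ ≤ l * R ∧ ‖z.2‖ ≤ l * R ^ (1 + γ)}

lemma measurableSet_boxG (l R : ℝ) : MeasurableSet (boxG n m γ l R) := by
  unfold boxG
  rw [Set.ofPred_and]
  exact (measurableSet_le (by fun_prop) (by fun_prop)).inter
    (measurableSet_le (by fun_prop) (by fun_prop))

lemma setLIntegral_eq_lintegral_indicator_one_mul {α : Type*} [MeasurableSpace α] {μ : Measure α}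
    {S : Set α} (hS : MeasurableSet S) (g : α → ℝ≥0∞) :
    ∫⁻ z in S, g z ∂μ = ∫⁻ z, S.indicator 1 z * g z ∂μ := by
  rw [← lintegral_indicator hS]
  refine lintegral_congr fun z => ?_
  by_cases hz : z ∈ S <;> simp [hz]

lemma indicator_one_le_indicator_one {α : Type*} {S S' : Set α} {z z' : α} (h : z ∈ S → z' ∈ S') :
    S.indicator (1 : α → ℝ≥0∞) z ≤ S'.indicator 1 z' := by
  by_cases hz : z ∈ S
  · simp [hz, h hz]
  · simp [hz]

lemma rpow_le_self_mul {q a x : ℝ} (hq : 1 ≤ q) (ha : 0 ≤ a) (ha1 : a ≤ 1) (hx : 0 ≤ x) :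
    (a * x) ^ q ≤ a * x ^ q := by
  rw [Real.mul_rpow ha hx]
  gcongr
  calc a ^ q ≤ a ^ (1 : ℝ) := Real.rpow_le_rpow_of_exponent_ge' ha ha1 (by norm_num) hq
    _ = a := Real.rpow_one a

lemma lintegral_translate_fst_le {q R a : ℝ} (hq : 1 ≤ q) (hR : 1 ≤ R) (ha : 0 < a)
    (ha3 : 3 * a ≤ 1) {f : GrushinSpace n m → ℝ} (hf : ContDiff ℝ 1 f)
    {h : EuclideanSpace ℝ (Fin n)} (hh : ‖h‖ ≤ 3 * a) :
    ∫⁻ z in boxG n m γ 1 R, ENNReal.ofReal (|f (z.1 + h, z.2) - f z| ^ q) ≤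
      ENNReal.ofReal (3 * a) * ∫⁻ z in boxG n m γ 2 R, ENNReal.ofReal (gradNormG γ f z ^ q) := by
  have key := lintegral_translate_fst_sub_le (γ := γ) hq hf (g := fun _ => h) measurable_const
    (w := (boxG n m γ 1 R).indicator 1) (w' := (boxG n m γ 2 R).indicator 1)
    (measurable_one.indicator (measurableSet_boxG 2 R)) (fun z t ht => by
      refine indicator_one_le_indicator_one fun hz => ⟨?_, ?_⟩
      · have h1 := norm_add_le z.1 (t • h)
        rw [norm_smul, Real.norm_of_nonneg ht.1.le] at h1
        have h2 : t * ‖h‖ ≤ 1 * ‖h‖ := mul_le_mul_of_nonneg_right ht.2 (norm_nonneg _)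
        have := hz.1
        simp only
        linarith
      · have := hz.2
        have : 0 ≤ R ^ (1 + γ) := by positivity
        simp only
        linarith)
  rw [setLIntegral_eq_lintegral_indicator_one_mul (measurableSet_boxG 1 R),
    setLIntegral_eq_lintegral_indicator_one_mul (measurableSet_boxG 2 R),
    ← lintegral_const_mul' _ _ ENNReal.ofReal_ne_top]
  refine key.trans (lintegral_mono fun z => ?_)
  rw [mul_left_comm, ← ENNReal.ofReal_mul (by positivity)]
  refine mul_le_mul_right (ENNReal.ofReal_le_ofReal ?_) _
  have hΓ := gradNormG_nonneg γ f z
  refine le_trans ?_ (rpow_le_self_mul hq (by positivity) ha3 hΓ)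
  rw [mul_comm]
  gcongr

lemma lintegral_translate_snd_le {q R a : ℝ} (hγ : 0 ≤ γ) (hq : 1 ≤ q) (hR : 1 ≤ R) (ha : 0 < a)
    (ha3 : 3 * a ≤ 1) {f : GrushinSpace n m → ℝ} (hf : ContDiff ℝ 1 f)
    {S : Set (GrushinSpace n m)} (hS : MeasurableSet S) (hSR : S ⊆ boxG n m γ 1 R)
    {h : EuclideanSpace ℝ (Fin n)} (hh : ‖h‖ ≤ 3 * a) (hSh : ∀ z ∈ S, a ≤ ‖z.1 + h‖)
    {k : EuclideanSpace ℝ (Fin m)} (hk : ‖k‖ ≤ a ^ (1 + γ)) :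
    ∫⁻ z in S, ENNReal.ofReal (|f (z.1 + h, z.2 + k) - f (z.1 + h, z.2)| ^ q) ≤
      ENNReal.ofReal (3 * a) * ∫⁻ z in boxG n m γ 2 R, ENNReal.ofReal (gradNormG γ f z ^ q) := by
  set W : Set (GrushinSpace n m) := {z | a ≤ ‖z.1‖} ∩ {z | ‖z.1‖ ≤ 2 * R ∧ ‖z.2‖ ≤ R ^ (1 + γ)}
  set W' : Set (GrushinSpace n m) := {z | a ≤ ‖z.1‖} ∩ boxG n m γ 2 R
  have hA : MeasurableSet {z : GrushinSpace n m | a ≤ ‖z.1‖} :=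
    measurableSet_le (by fun_prop) (by fun_prop)
  have hWm : MeasurableSet W := by
    refine hA.inter ?_
    rw [Set.ofPred_and]
    exact (measurableSet_le (by fun_prop) (by fun_prop)).inter
      (measurableSet_le (by fun_prop) (by fun_prop))
  have hWm' : MeasurableSet W' := hA.inter (measurableSet_boxG 2 R)
  have hfm := hf.continuous.measurable
  have h1 : ∫⁻ z in S, ENNReal.ofReal (|f (z.1 + h, z.2 + k) - f (z.1 + h, z.2)| ^ q) ≤
      ∫⁻ z, W.indicator 1 z * ENNReal.ofReal (|f (z.1, z.2 + k) - f z| ^ q) := by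
    have hmp : MeasurePreserving (fun z : GrushinSpace n m => (z.1 + h, z.2)) := by
      simpa using measurePreserving_shear (n := n) (m := m) (measurable_const (a := h)) 0
    have hgm : Measurable fun z : GrushinSpace n m =>
        W.indicator (1 : GrushinSpace n m → ℝ≥0∞) z *
          ENNReal.ofReal (|f (z.1, z.2 + k) - f z| ^ q) :=
      (measurable_one.indicator hWm).mul (by fun_prop)
    rw [← hmp.lintegral_comp hgm, setLIntegral_eq_lintegral_indicator_one_mul hS]
    refine lintegral_mono fun z => mul_le_mul_left (indicator_one_le_indicator_one fun hz => ?_) _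
    refine ⟨hSh z hz, ?_, ?_⟩
    · have := (hSR hz).1
      have := norm_add_le z.1 h
      simp only
      linarith
    · simpa using (hSR hz).2
  have h2 := lintegral_translate_snd_sub_le hq hf k (w := W.indicator 1) (w' := W'.indicator 1)
    (measurable_one.indicator hWm') (fun z t ht => by
      refine indicator_one_le_indicator_one fun hz => ⟨hz.1, hz.2.1, ?_⟩
      have h1 := norm_add_le z.2 (t • k)
      rw [norm_smul, Real.norm_of_nonneg ht.1.le] at h1
      have h2 : t * ‖k‖ ≤ 1 * ‖k‖ := mul_le_mul_of_nonneg_right ht.2 (norm_nonneg _)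
      have h3 : a ^ (1 + γ) ≤ R ^ (1 + γ) := by
        gcongr
        linarith
      have := hz.2.2
      simp only
      linarith)
  refine (h1.trans h2).trans ?_
  rw [setLIntegral_eq_lintegral_indicator_one_mul (measurableSet_boxG 2 R),
    ← lintegral_const_mul' _ _ ENNReal.ofReal_ne_top]
  refine lintegral_mono fun z => ?_
  by_cases hz : z ∈ W'
  · have hz2 : z ∈ boxG n m γ 2 R := hz.2
    rw [Set.indicator_of_mem hz, Set.indicator_of_mem hz2]
    simp only [Pi.one_apply, one_mul]
    rw [← ENNReal.ofReal_mul (by positivity)]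
    apply ENNReal.ofReal_le_ofReal
    have hΓ := gradNormG_nonneg γ f z
    have h3 : |fderiv ℝ f z (0, k)| ≤ a * gradNormG γ f z := by
      have h4 := abs_fderiv_snd_le_gradNormG γ f z k
      have h5 : a ^ γ ≤ ‖z.1‖ ^ γ := Real.rpow_le_rpow ha.le hz.1 hγ
      have h6 : 0 < a ^ γ := by positivity
      rw [Real.rpow_add ha, Real.rpow_one] at hk
      refine le_of_mul_le_mul_left ?_ h6
      calc a ^ γ * |fderiv ℝ f z (0, k)| ≤ ‖z.1‖ ^ γ * |fderiv ℝ f z (0, k)| := by gcongr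
        _ ≤ gradNormG γ f z * (a * a ^ γ) := h4.trans (by gcongr)
        _ = _ := by ring
    calc |fderiv ℝ f z (0, k)| ^ q ≤ (a * gradNormG γ f z) ^ q := by gcongr
      _ ≤ a * gradNormG γ f z ^ q := rpow_le_self_mul hq ha.le (by linarith) hΓ
      _ ≤ _ := by
        gcongr
        linarith
  · rw [Set.indicator_of_notMem hz, zero_mul]
    exact zero_le

/-- The increments used to average around a point, moving away from `x = 0` in direction `e`. -/
def coneG (γ a : ℝ) (e : EuclideanSpace ℝ (Fin n)) (m : ℕ) : Set (GrushinSpace n m) :=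
  Metric.ball ((2 * a) • e) a ×ˢ Metric.ball 0 (a ^ (1 + γ))

lemma volume_coneG_ne_top (γ a : ℝ) (e : EuclideanSpace ℝ (Fin n)) :
    volume (coneG γ a e m) ≠ ∞ := by
  rw [coneG, Measure.volume_eq_prod, Measure.prod_prod]
  exact ENNReal.mul_ne_top measure_ball_lt_top.ne measure_ball_lt_top.ne

lemma lintegral_half_boxG_le {q R a : ℝ} (hγ : 0 ≤ γ) (hq : 1 ≤ q) (hq2 : q ≤ 2) (hR : 1 ≤ R)
    (ha : 0 < a) (ha3 : 3 * a ≤ 1) {f : GrushinSpace n m → ℝ} (hf : ContDiff ℝ 1 f)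
    {e : EuclideanSpace ℝ (Fin n)} (he : ‖e‖ = 1) :
    volume (coneG γ a e m) ^ 2 *
        ∫⁻ z in boxG n m γ 1 R ∩ {z | 0 ≤ inner ℝ e z.1}, ENNReal.ofReal (|f z| ^ q) ≤
      volume (coneG γ a e m) ^ 2 * (ENNReal.ofReal (24 * a) *
          ∫⁻ z in boxG n m γ 2 R, ENNReal.ofReal (gradNormG γ f z ^ q)) +
        2 * volume (boxG n m γ 1 R) *
          (∫⁻ z in boxG n m γ 2 R, ENNReal.ofReal (|f z| ^ (q / 2))) ^ 2 := by
  set S : Set (GrushinSpace n m) := boxG n m γ 1 R ∩ {z | 0 ≤ inner ℝ e z.1}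
  set B := coneG γ a e m
  set Φ := ∫⁻ z in boxG n m γ 2 R, ENNReal.ofReal (|f z| ^ (q / 2))
  set Γ := ∫⁻ z in boxG n m γ 2 R, ENNReal.ofReal (gradNormG γ f z ^ q)
  have hB : volume B ≠ ∞ := volume_coneG_ne_top γ a e
  have hBm : MeasurableSet B := measurableSet_ball.prod measurableSet_ball
  have hSm : MeasurableSet S :=
    (measurableSet_boxG 1 R).inter (measurableSet_le (by fun_prop) (by fun_prop))
  have hfc := hf.continuous
  have hq0 : 0 ≤ q / 2 := by linarith
  have hBh : ∀ w ∈ B, ‖w.1‖ ≤ 3 * a ∧ a ≤ inner ℝ e w.1 ∧ ‖w.2‖ ≤ a ^ (1 + γ) := by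
    intro w hw
    have h1 : ‖w.1 - (2 * a) • e‖ < a := by simpa [dist_eq_norm] using hw.1
    have h2 : ‖(2 * a) • e‖ = 2 * a := by
      rw [norm_smul, he, mul_one, Real.norm_of_nonneg (by positivity)]
    refine ⟨?_, ?_, by simpa using (Metric.mem_ball.1 hw.2).le⟩
    · have := norm_le_norm_sub_add w.1 ((2 * a) • e)
      linarith
    · have h3 := abs_real_inner_le_norm e (w.1 - (2 * a) • e)
      rw [inner_sub_right, inner_smul_right, real_inner_self_eq_norm_sq, he] at h3
      have := (abs_le.1 h3).1
      linarith
  have hSh : ∀ w ∈ B, ∀ z ∈ S, a ≤ ‖z.1 + w.1‖ := by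
    intro w hw z hz
    have h1 := real_inner_le_norm e (z.1 + w.1)
    rw [he, one_mul, inner_add_right] at h1
    have := (hBh w hw).2.1
    have : 0 ≤ inner ℝ e z.1 := hz.2
    linarith
  have hJ : ∀ z ∈ S, ∫⁻ w in B, ENNReal.ofReal (|f (z.1 + w.1, z.2 + w.2)| ^ (q / 2)) ≤ Φ := by
    intro z hz
    have hmp : MeasurePreserving (fun w : GrushinSpace n m => (z.1 + w.1, z.2 + w.2)) := by
      simpa [add_comm] using
        measurePreserving_shear (n := n) (m := m) (measurable_const (a := z.1)) z.2
    have hgm : Measurable fun w : GrushinSpace n m =>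
        (boxG n m γ 2 R).indicator (1 : GrushinSpace n m → ℝ≥0∞) w *
          ENNReal.ofReal (|f w| ^ (q / 2)) := by
      have := hfc.measurable
      exact (measurable_one.indicator (measurableSet_boxG 2 R)).mul (by fun_prop)
    simp only [Φ]
    rw [setLIntegral_eq_lintegral_indicator_one_mul (measurableSet_boxG 2 R),
      setLIntegral_eq_lintegral_indicator_one_mul hBm, ← hmp.lintegral_comp hgm]
    refine lintegral_mono fun w => mul_le_mul_left (indicator_one_le_indicator_one fun hw => ?_) _
    have h1 := hBh w hw
    have h2 := hz.1
    have h3 := norm_add_le z.1 w.1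
    have h4 := norm_add_le z.2 w.2
    have h5 : a ^ (1 + γ) ≤ R ^ (1 + γ) := by
      gcongr
      linarith
    refine ⟨?_, ?_⟩
    · have := h2.1
      simp only
      linarith
    · have := h2.2
      simp only
      linarith
  set A : GrushinSpace n m → GrushinSpace n m → ℝ≥0∞ := fun z w =>
    ENNReal.ofReal (|f (z.1 + w.1, z.2) - f z| ^ q) +
      ENNReal.ofReal (|f (z.1 + w.1, z.2 + w.2) - f (z.1 + w.1, z.2)| ^ q)
  have hfm := hfc.measurable
  have hpt : ∀ z ∈ S, volume B ^ 2 * ENNReal.ofReal (|f z| ^ q) ≤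
      4 * volume B * (∫⁻ w in B, A z w) + 2 * Φ ^ 2 := by
    intro z hz
    have h1 := ENNReal.sq_mul_sq_le_of_le_add (volume.restrict B)
      (ENNReal.ofReal (|f z| ^ (q / 2)))
      (A := fun w => ENNReal.ofReal (|f (z.1 + w.1, z.2) - f z| ^ (q / 2)))
      (B := fun w => ENNReal.ofReal (|f (z.1 + w.1, z.2 + w.2) - f (z.1 + w.1, z.2)| ^ (q / 2)))
      (J := fun w => ENNReal.ofReal (|f (z.1 + w.1, z.2 + w.2)| ^ (q / 2)))
      (by fun_prop) (by fun_prop)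
      (Filter.Eventually.of_forall fun w => ofReal_abs_rpow_le_add hq0 (by linarith) _ _ _)
    simp only [ofReal_abs_rpow_half_sq, Measure.restrict_apply_univ] at h1
    refine h1.trans ?_
    gcongr
    exact hJ z hz
  have hswap : ∫⁻ z in S, ∫⁻ w in B, A z w ≤ volume B * (ENNReal.ofReal (6 * a) * Γ) := by
    rw [lintegral_lintegral_swap (by unfold Function.uncurry; fun_prop)]
    calc ∫⁻ w in B, ∫⁻ z in S, A z w ≤ ∫⁻ _ in B, ENNReal.ofReal (6 * a) * Γ := by
          refine setLIntegral_mono' hBm fun w hw => ?_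
          obtain ⟨h1, -, h3⟩ := hBh w hw
          rw [lintegral_add_left (by fun_prop)]
          have e1 := lintegral_translate_fst_le (γ := γ) hq hR ha ha3 hf h1
          have e2 := lintegral_translate_snd_le hγ hq hR ha ha3 hf hSm Set.inter_subset_left h1
            (hSh w hw) h3
          refine (add_le_add ((lintegral_mono_set Set.inter_subset_left).trans e1) e2).trans ?_
          rw [← add_mul, ← ENNReal.ofReal_add (by positivity) (by positivity)]
          gcongr
          linarith
      _ = _ := by rw [setLIntegral_const, mul_comm]
  calc volume B ^ 2 * ∫⁻ z in S, ENNReal.ofReal (|f z| ^ q)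
      = ∫⁻ z in S, volume B ^ 2 * ENNReal.ofReal (|f z| ^ q) :=
        (lintegral_const_mul' _ _ (ENNReal.pow_ne_top hB)).symm
    _ ≤ ∫⁻ z in S, (4 * volume B * (∫⁻ w in B, A z w) + 2 * Φ ^ 2) := setLIntegral_mono' hSm hpt
    _ = 4 * volume B * (∫⁻ z in S, ∫⁻ w in B, A z w) + 2 * Φ ^ 2 * volume S := by
        rw [lintegral_add_right _ measurable_const, setLIntegral_const,
          lintegral_const_mul' _ _ (ENNReal.mul_ne_top (by norm_num) hB)]
    _ ≤ 4 * volume B * (volume B * (ENNReal.ofReal (6 * a) * Γ)) +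
          2 * Φ ^ 2 * volume (boxG n m γ 1 R) := by
        gcongr
        exact Set.inter_subset_left
    _ = _ := by
        rw [show 24 * a = 4 * (6 * a) by ring, ENNReal.ofReal_mul (p := 4) (by norm_num),
          ENNReal.ofReal_ofNat]
        ring

/-- The product of the volumes of the Euclidean unit balls of `ℝⁿ` and `ℝᵐ`. -/
noncomputable def ballVolG (n m : ℕ) : ℝ :=
  (volume (Metric.ball (0 : EuclideanSpace ℝ (Fin n)) 1)).toReal *
    (volume (Metric.ball (0 : EuclideanSpace ℝ (Fin m)) 1)).toReal

lemma ballVolG_pos (n m : ℕ) : 0 < ballVolG n m :=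
  mul_pos (ENNReal.toReal_pos (Metric.measure_ball_pos _ _ one_pos).ne' measure_ball_lt_top.ne)
    (ENNReal.toReal_pos (Metric.measure_ball_pos _ _ one_pos).ne' measure_ball_lt_top.ne)

lemma ofReal_pow_mul_rpow_pow_mul_ballVolG (n m : ℕ) (γ : ℝ) {r : ℝ} (hr : 0 < r) :
    ENNReal.ofReal (r ^ n) * volume (Metric.ball (0 : EuclideanSpace ℝ (Fin n)) 1) *
        (ENNReal.ofReal ((r ^ (1 + γ)) ^ m) *
          volume (Metric.ball (0 : EuclideanSpace ℝ (Fin m)) 1)) =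
      ENNReal.ofReal (r ^ (n + (1 + γ) * m) * ballVolG n m) := by
  rw [Real.rpow_add hr n ((1 + γ) * m), Real.rpow_mul hr.le (1 + γ) m, Real.rpow_natCast,
    Real.rpow_natCast, ballVolG,
    ENNReal.ofReal_mul (by positivity), ENNReal.ofReal_mul (by positivity),
    ENNReal.ofReal_mul ENNReal.toReal_nonneg, ENNReal.ofReal_toReal measure_ball_lt_top.ne,
    ENNReal.ofReal_toReal measure_ball_lt_top.ne]
  ring

lemma volume_coneG (γ : ℝ) {a : ℝ} (ha : 0 < a) (e : EuclideanSpace ℝ (Fin n)) :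
    volume (coneG γ a e m) = ENNReal.ofReal (a ^ (n + (1 + γ) * m) * ballVolG n m) := by
  rw [coneG, Measure.volume_eq_prod, Measure.prod_prod, Measure.addHaar_ball_of_pos _ _ ha,
    Measure.addHaar_ball_of_pos _ _ (Real.rpow_pos_of_pos ha (1 + γ)),
    ← ofReal_pow_mul_rpow_pow_mul_ballVolG n m γ ha]
  simp

lemma volume_boxG (γ : ℝ) {R : ℝ} (hR : 0 < R) :
    volume (boxG n m γ 1 R) = ENNReal.ofReal (R ^ (n + (1 + γ) * m) * ballVolG n m) := by
  have : boxG n m γ 1 R = Metric.closedBall 0 R ×ˢ Metric.closedBall 0 (R ^ (1 + γ)) := by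
    ext z
    simp [boxG]
  rw [this, Measure.volume_eq_prod, Measure.prod_prod, Measure.addHaar_closedBall _ _ hR.le,
    Measure.addHaar_closedBall _ _ (by positivity), ← ofReal_pow_mul_rpow_pow_mul_ballVolG n m γ hR]
  simp

lemma lintegral_boxG_le (hn : 1 ≤ n) {q R a : ℝ} (hγ : 0 ≤ γ) (hq : 1 ≤ q) (hq2 : q ≤ 2)
    (hR : 1 ≤ R) (ha : 0 < a) (ha3 : 3 * a ≤ 1) {f : GrushinSpace n m → ℝ}
    (hf : ContDiff ℝ 1 f) :
    ∫⁻ z in boxG n m γ 1 R, ENNReal.ofReal (|f z| ^ q) ≤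
      ENNReal.ofReal (48 * a) * (∫⁻ z in boxG n m γ 2 R, ENNReal.ofReal (gradNormG γ f z ^ q)) +
        ENNReal.ofReal (4 * (R / a ^ 2) ^ (n + (1 + γ) * m) / ballVolG n m) *
          (∫⁻ z in boxG n m γ 2 R, ENNReal.ofReal (|f z| ^ (q / 2))) ^ 2 := by
  obtain ⟨e, he⟩ := exists_norm_eq_one hn
  have hω := ballVolG_pos n m
  set ω := ballVolG n m
  set d : ℝ := n + (1 + γ) * m
  set Φ := ∫⁻ z in boxG n m γ 2 R, ENNReal.ofReal (|f z| ^ (q / 2))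
  set Γ := ∫⁻ z in boxG n m γ 2 R, ENNReal.ofReal (gradNormG γ f z ^ q)
  have hR0 : 0 < R := by linarith
  have half : ∀ e : EuclideanSpace ℝ (Fin n), ‖e‖ = 1 →
      ∫⁻ z in boxG n m γ 1 R ∩ {z | 0 ≤ inner ℝ e z.1}, ENNReal.ofReal (|f z| ^ q) ≤
        ENNReal.ofReal (24 * a) * Γ + ENNReal.ofReal (2 * (R / a ^ 2) ^ d / ω) * Φ ^ 2 := by
    intro e he
    have h1 := lintegral_half_boxG_le (m := m) hγ hq hq2 hR ha ha3 hf he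
    rw [volume_coneG γ ha, volume_boxG γ hR0] at h1
    have hv0 : ENNReal.ofReal (a ^ d * ω) ^ 2 ≠ 0 := by
      have : 0 < a ^ d * ω := by positivity
      exact pow_ne_zero _ (ENNReal.ofReal_pos.2 this).ne'
    rw [← ENNReal.mul_le_mul_iff_right hv0 (ENNReal.pow_ne_top ENNReal.ofReal_ne_top)]
    refine h1.trans (le_of_eq ?_)
    rw [mul_add]
    congr 1
    rw [← mul_assoc, ← ENNReal.ofReal_pow (by positivity), ← ENNReal.ofReal_mul (by positivity)]
    congr 1
    suffices h : (a ^ d * ω) ^ 2 * (2 * (R / a ^ 2) ^ d / ω) = 2 * (R ^ d * ω) by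
      rw [h, ENNReal.ofReal_mul (p := 2) (by norm_num), ENNReal.ofReal_ofNat]
    rw [Real.div_rpow hR0.le (by positivity), ← Real.rpow_natCast a, ← Real.rpow_mul ha.le,
      mul_comm _ d, Real.rpow_mul ha.le, Real.rpow_natCast]
    field_simp
  have hcov : boxG n m γ 1 R ⊆ (boxG n m γ 1 R ∩ {z | 0 ≤ inner ℝ e z.1}) ∪
      (boxG n m γ 1 R ∩ {z | 0 ≤ inner ℝ (-e) z.1}) := by
    intro z hz
    rcases le_total 0 (inner ℝ e z.1) with h | h
    · exact Or.inl ⟨hz, h⟩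
    · exact Or.inr ⟨hz, by simpa using h⟩
  refine (lintegral_mono_set hcov).trans ((lintegral_union_le _ _ _).trans
    ((add_le_add (half e he) (half (-e) (by rwa [norm_neg]))).trans (le_of_eq ?_)))
  rw [show 48 * a = 2 * (24 * a) by ring,
    show 4 * (R / a ^ 2) ^ d / ω = 2 * (2 * (R / a ^ 2) ^ d / ω) by ring,
    ENNReal.ofReal_mul (p := 2) (by norm_num), ENNReal.ofReal_mul (p := 2) (by norm_num),
    ENNReal.ofReal_ofNat]
  ring

lemma exists_exp_neg_le_densG {p : ℝ} (hγ : 0 ≤ γ) (hp : 0 ≤ p) :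
    ∃ c : ℝ, 0 ≤ c ∧ ∀ R : ℝ, 0 < R → ∀ z ∈ boxG n m γ 2 R,
      Real.exp (-(c * R ^ p)) ≤ densG γ p z := by
  refine ⟨(2 ^ (2 * (1 + γ)) + (1 + γ) ^ 2 * 4) ^ (p / (2 + 2 * γ)), by positivity,
    fun R hR z hz => ?_⟩
  unfold densG
  rw [Real.exp_le_exp, neg_le_neg_iff, GKaplan_rpow hγ]
  have h1 : R ^ p = (R ^ (2 * (1 + γ))) ^ (p / (2 + 2 * γ)) := by
    rw [← Real.rpow_mul hR.le]
    congr 1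
    field_simp
  rw [h1, ← Real.mul_rpow (by positivity) (by positivity)]
  have h2 : ‖z.1‖ ^ (2 * (1 + γ)) ≤ (2 * R) ^ (2 * (1 + γ)) := by
    have := hz.1
    gcongr
  have h3 : ‖z.2‖ ^ 2 ≤ 4 * R ^ (2 * (1 + γ)) := by
    calc ‖z.2‖ ^ 2 ≤ (2 * R ^ (1 + γ)) ^ 2 := by
          have := hz.2
          gcongr
      _ = _ := by
        rw [mul_pow, ← Real.rpow_mul_natCast hR.le, mul_comm (1 + γ)]
        norm_num
  rw [Real.mul_rpow (by norm_num) hR.le] at h2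
  have h4 : 0 ≤ (1 + γ) ^ 2 := by positivity
  gcongr
  nlinarith

/-- Local super-Poincaré inequality for `e ^ (-N ^ p) dξ` on the box of size `R`. -/
lemma exists_lintegral_densG_boxG_le (hn : 1 ≤ n) {p q : ℝ} (hγ : 0 ≤ γ) (hp : 1 ≤ p)
    (hq : 1 ≤ q) (hq2 : q ≤ 2) :
    ∃ C : ℝ, 0 ≤ C ∧ ∀ R : ℝ, 1 ≤ R → ∀ f : GrushinSpace n m → ℝ, ContDiff ℝ 1 f →
      ∫⁻ z in boxG n m γ 1 R, ENNReal.ofReal (densG γ p z) * ENNReal.ofReal (|f z| ^ q) ≤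
        ENNReal.ofReal (16 * Real.exp (-(R ^ p))) *
          (∫⁻ z, ENNReal.ofReal (densG γ p z) * ENNReal.ofReal (gradNormG γ f z ^ q)) +
        ENNReal.ofReal (Real.exp (C * R ^ p)) *
          (∫⁻ z, ENNReal.ofReal (densG γ p z) * ENNReal.ofReal (|f z| ^ (q / 2))) ^ 2 := by
  obtain ⟨c, hc0, hc⟩ := exists_exp_neg_le_densG (n := n) (m := m) hγ (p := p) (by linarith)
  have hω := ballVolG_pos n m
  set ω := ballVolG n m
  set d : ℝ := n + (1 + γ) * m with hd
  have hd0 : 0 ≤ d := by positivity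
  set M : ℝ := 4 * 9 ^ d / ω with hM
  refine ⟨M + d * (1 + 2 * (c + 1)) + 2 * c, by positivity, fun R hR f hf => ?_⟩
  have hR0 : 0 < R := by linarith
  have hRp : 1 ≤ R ^ p := Real.one_le_rpow hR (by linarith)
  set a := Real.exp (-((c + 1) * R ^ p)) / 3 with ha
  have ha0 : 0 < a := by positivity
  have ha3 : 3 * a ≤ 1 := by
    rw [ha, mul_div_cancel₀ _ (by norm_num), Real.exp_le_one_iff, neg_nonpos]
    positivity
  have hbox : ∀ g : GrushinSpace n m → ℝ≥0∞, ∫⁻ z in boxG n m γ 2 R, g z ≤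
      ENNReal.ofReal (Real.exp (c * R ^ p)) * ∫⁻ z, ENNReal.ofReal (densG γ p z) * g z := by
    intro g
    rw [← lintegral_const_mul' _ _ ENNReal.ofReal_ne_top]
    refine (setLIntegral_mono' (measurableSet_boxG 2 R) fun z hz => ?_).trans
      (setLIntegral_le_lintegral _ _)
    rw [← mul_assoc, ← ENNReal.ofReal_mul (by positivity)]
    refine le_mul_of_one_le_left zero_le ?_
    rw [← ENNReal.ofReal_one]
    apply ENNReal.ofReal_le_ofReal
    calc (1 : ℝ) = Real.exp (c * R ^ p) * Real.exp (-(c * R ^ p)) := by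
          rw [← Real.exp_add, add_neg_cancel, Real.exp_zero]
      _ ≤ _ := by
          gcongr
          exact hc R hR0 z hz
  have hdens : ∫⁻ z in boxG n m γ 1 R, ENNReal.ofReal (densG γ p z) * ENNReal.ofReal (|f z| ^ q) ≤
      ∫⁻ z in boxG n m γ 1 R, ENNReal.ofReal (|f z| ^ q) := by
    refine lintegral_mono fun z => mul_le_of_le_one_left zero_le ?_
    rw [ENNReal.ofReal_le_one, densG, Real.exp_le_one_iff, neg_nonpos]
    exact Real.rpow_nonneg (GKaplan_nonneg hγ z) p
  refine hdens.trans ((lintegral_boxG_le hn hγ hq hq2 hR ha0 ha3 hf).trans ?_)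
  refine (add_le_add (mul_le_mul_right (hbox _) _)
    (mul_le_mul_right (pow_le_pow_left' (hbox _) 2) _)).trans ?_
  rw [mul_pow, ← mul_assoc, ← mul_assoc, ← ENNReal.ofReal_pow (by positivity),
    ← ENNReal.ofReal_mul (by positivity), ← ENNReal.ofReal_mul (by positivity)]
  refine add_le_add (mul_le_mul_left (ENNReal.ofReal_le_ofReal ?_) _)
    (mul_le_mul_left (ENNReal.ofReal_le_ofReal ?_) _)
  · have h1 : -(R ^ p) = -((c + 1) * R ^ p) + c * R ^ p := by ring
    rw [ha, h1, Real.exp_add]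
    linarith
  · have h1 : R / a ^ 2 ≤ 9 * Real.exp ((1 + 2 * (c + 1)) * R ^ p) := by
      have h2 : R ≤ Real.exp (R ^ p) := by
        have h3 := Real.add_one_le_exp (R ^ p)
        have h4 : R ^ (1 : ℝ) ≤ R ^ p := Real.rpow_le_rpow_of_exponent_le hR hp
        rw [Real.rpow_one] at h4
        linarith
      rw [div_le_iff₀ (by positivity), ha, div_pow, ← Real.exp_nat_mul]
      calc R ≤ Real.exp (R ^ p) := h2
        _ = Real.exp ((1 + 2 * (c + 1)) * R ^ p) *
            Real.exp ((2 : ℕ) * -((c + 1) * R ^ p)) := by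
          rw [← Real.exp_add]
          congr 1
          push_cast
          ring
        _ = _ := by ring
    have h2 : (R / a ^ 2) ^ d ≤ 9 ^ d * Real.exp (d * (1 + 2 * (c + 1)) * R ^ p) := by
      refine (Real.rpow_le_rpow (by positivity) h1 hd0).trans (le_of_eq ?_)
      rw [Real.mul_rpow (by norm_num) (by positivity), ← Real.exp_mul]
      congr 2
      ring
    have h3 : M ≤ Real.exp (M * R ^ p) := by
      have h4 := Real.add_one_le_exp (M * R ^ p)
      have h5 : 0 ≤ M := by positivity
      nlinarith
    calc 4 * (R / a ^ 2) ^ d / ω * Real.exp (c * R ^ p) ^ 2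
        ≤ 4 * (9 ^ d * Real.exp (d * (1 + 2 * (c + 1)) * R ^ p)) / ω *
            Real.exp (c * R ^ p) ^ 2 := by gcongr
      _ = M * (Real.exp (d * (1 + 2 * (c + 1)) * R ^ p) * Real.exp (c * R ^ p) ^ 2) := by
          rw [hM]
          ring
      _ ≤ Real.exp (M * R ^ p) *
            (Real.exp (d * (1 + 2 * (c + 1)) * R ^ p) * Real.exp (c * R ^ p) ^ 2) := by gcongr
      _ = _ := by
          rw [← Real.exp_nat_mul, ← Real.exp_add, ← Real.exp_add]
          congr 1
          push_cast
          ring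

lemma lintegral_densG_mul_lt_top {p : ℝ} (hγ : 0 ≤ γ) (hp : 0 ≤ p) {g : GrushinSpace n m → ℝ}
    (hg : Continuous g) (hgc : HasCompactSupport g) :
    ∫⁻ z, ENNReal.ofReal (densG γ p z) * ENNReal.ofReal (g z) < ∞ := by
  have h : Integrable fun z => densG γ p z * g z :=
    ((continuous_densG hγ hp).mul hg).integrable_of_hasCompactSupport hgc.mul_left
  simp_rw [← ENNReal.ofReal_mul (densG_pos γ p _).le]
  exact h.lintegral_lt_top

lemma integral_muG {p : ℝ} (hγ : 0 ≤ γ) (hp : 0 ≤ p) {g : GrushinSpace n m → ℝ}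
    (hg : Continuous g) (hg0 : ∀ z, 0 ≤ g z) :
    ∫ z, g z ∂(muG n m γ p) = (∫ z : GrushinSpace n m, densG γ p z)⁻¹ *
      (∫⁻ z, ENNReal.ofReal (densG γ p z) * ENNReal.ofReal (g z)).toReal := by
  have hZ : 0 ≤ (∫ z : GrushinSpace n m, densG γ p z)⁻¹ :=
    inv_nonneg.2 (integral_nonneg fun z => (densG_pos γ p z).le)
  have hd := (continuous_densG (n := n) (m := m) hγ hp).measurable
  have hmu : muG n m γ p = volume.withDensity fun z =>
      ENNReal.ofReal ((∫ z : GrushinSpace n m, densG γ p z)⁻¹ * densG γ p z) := rfl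
  rw [integral_eq_lintegral_of_nonneg_ae (Filter.Eventually.of_forall hg0)
    hg.aestronglyMeasurable, hmu, lintegral_withDensity_eq_lintegral_mul _ (by fun_prop)
      hg.measurable.ennreal_ofReal]
  simp_rw [Pi.mul_apply, ENNReal.ofReal_mul hZ, mul_assoc]
  rw [lintegral_const_mul' _ _ ENNReal.ofReal_ne_top, ENNReal.toReal_mul, ENNReal.toReal_ofReal hZ]

/-- Choice of the truncation radius: `R ^ s` beats `K / ε`, at controlled cost for `R ^ p`. -/
lemma exists_radius {K s p : ℝ} (hK : 1 ≤ K) (hs : 0 < s) {ε : ℝ} (hε : 0 < ε) :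
    ∃ R : ℝ, 1 ≤ R ∧ K * R ^ (-s) ≤ 1 ∧ K * R ^ (-s) ≤ ε ∧
      R ^ p ≤ K ^ (p / s) * (1 + ε ^ (-(p / s))) := by
  have hM1 : 1 ≤ max 1 ε⁻¹ := le_max_left _ _
  have hM0 : 0 < max 1 ε⁻¹ := by linarith
  have hK0 : 0 < K := by linarith
  have hR0 : 0 < (K * max 1 ε⁻¹) ^ (1 / s) := by positivity
  have hRs : K * ((K * max 1 ε⁻¹) ^ (1 / s)) ^ (-s) = (max 1 ε⁻¹)⁻¹ := by
    rw [Real.rpow_neg hR0.le, ← Real.rpow_mul (by positivity), one_div_mul_cancel hs.ne',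
      Real.rpow_one]
    field_simp
  refine ⟨(K * max 1 ε⁻¹) ^ (1 / s), ?_, ?_, ?_, ?_⟩
  · exact Real.one_le_rpow (by nlinarith) (by positivity)
  · rw [hRs]
    exact inv_le_one_of_one_le₀ hM1
  · rw [hRs]
    exact inv_le_of_inv_le₀ hε (le_max_right _ _)
  · rw [← Real.rpow_mul (by positivity), one_div_mul_eq_div,
      Real.mul_rpow hK0.le hM0.le]
    gcongr
    have hτ : 0 ≤ ε ^ (-(p / s)) := by positivity
    rcases max_cases 1 ε⁻¹ with ⟨h, -⟩ | ⟨h, -⟩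
    · rw [h, Real.one_rpow]
      linarith
    · rw [h, Real.inv_rpow hε.le, ← Real.rpow_neg hε.le]
      linarith

/-- The exponent of the gain outside a box of size `R`. -/
lemma tailExp_le {p q : ℝ} (hγ : 0 ≤ γ) (hp : 1 + γ < p) (hp2 : 2 ≤ p) (hq : q = p / (p - 1)) :
    (1 + γ) * (axisExp γ p * q) ≤ p := by
  have hp1 : 0 < p - 1 := by linarith
  have h : (1 + γ) * (axisExp γ p * q) = (p - (1 + γ)) * p / ((1 + γ) * (p - 1)) := by
    rw [hq, axisExp]
    field_simp
  rw [h, div_le_iff₀ (by positivity)]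
  have h1 : p - (1 + γ) ≤ (1 + γ) * (p - 1) := by nlinarith
  nlinarith

lemma exp_neg_rpow_le {R s p : ℝ} (hR : 1 ≤ R) (hsp : s ≤ p) :
    Real.exp (-(R ^ p)) ≤ R ^ (-s) := by
  have hR0 : 0 < R := by linarith
  calc Real.exp (-(R ^ p)) = (Real.exp (R ^ p))⁻¹ := Real.exp_neg _
    _ ≤ (R ^ p)⁻¹ := by
        gcongr
        linarith [Real.add_one_le_exp (R ^ p)]
    _ = R ^ (-p) := (Real.rpow_neg hR0.le p).symm
    _ ≤ R ^ (-s) := Real.rpow_le_rpow_of_exponent_le hR (by linarith)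

lemma exists_toReal_lintegral_densG_le (hn : 1 ≤ n) {p q : ℝ} (hγ : 0 < γ) (hp : 1 + γ < p)
    (hp2 : 2 ≤ p) (hq : q = p / (p - 1)) :
    ∃ C : ℝ, 0 ≤ C ∧ ∀ ε : ℝ, 0 < ε → ∀ f : GrushinSpace n m → ℝ, ContDiff ℝ 1 f →
      HasCompactSupport f →
      (∫⁻ z, ENNReal.ofReal (densG γ p z) * ENNReal.ofReal (|f z| ^ q)).toReal ≤
        ε * (∫⁻ z, ENNReal.ofReal (densG γ p z) *
          ENNReal.ofReal (gradNormG γ f z ^ q)).toReal +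
        Real.exp (C * (1 + ε ^ (-((γ + 1) * (p - 1) / (p - γ - 1))))) *
          (∫⁻ z, ENNReal.ofReal (densG γ p z) *
            ENNReal.ofReal (|f z| ^ (q / 2))).toReal ^ 2 := by
  have hp1 : 0 < p - 1 := by linarith
  have hq1 : 1 ≤ q := by rw [hq, le_div_iff₀ hp1]; linarith
  have hq2 : q ≤ 2 := by rw [hq, div_le_iff₀ hp1]; linarith
  obtain ⟨c, hc0, hc⟩ := exists_lintegral_compl_le (n := n) (m := m) hn hγ.le hp hp2 hq
  obtain ⟨C, hC0, hC⟩ := exists_lintegral_densG_boxG_le (n := n) (m := m) (p := p) hn hγ.le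
    (by linarith) hq1 hq2
  set s := (1 + γ) * (axisExp γ p * q) with hs
  have hs0 : 0 < s := by
    have := axisExp_pos hγ.le hp
    positivity
  have hτ : p / s = (γ + 1) * (p - 1) / (p - γ - 1) := by
    have h1 : p - γ - 1 ≠ 0 := by linarith
    have h2 : p - (1 + γ) ≠ 0 := by linarith
    have h3 : p ≠ 0 := by linarith
    rw [hs, hq, axisExp]
    field_simp
    ring
  rw [← hτ]
  set Q : ℝ := n + (1 + γ) * m with hQ
  have hQ0 : 0 ≤ Q := by positivity
  set K : ℝ := 4 * c + 32 + 2 * c * Q with hK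
  have hcQ : 0 ≤ c * Q := by positivity
  refine ⟨1 + C * K ^ (p / s), by positivity, fun ε hε f hf hfc => ?_⟩
  obtain ⟨R, hR, hR1, hRε, hRp⟩ := exists_radius (K := K) (s := s) (p := p)
    (by linarith) hs0 hε
  have hF := (lintegral_densG_mul_lt_top hγ.le (p := p) (by linarith)
    (hf.continuous.abs.rpow_const fun z => Or.inr (by linarith : 0 ≤ q))
    (hfc.abs_rpow (by linarith))).ne
  have hJ := (lintegral_densG_mul_lt_top hγ.le (p := p) (by linarith)
    (hf.continuous.abs.rpow_const fun z => Or.inr (by linarith : 0 ≤ q / 2))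
    (hfc.abs_rpow (by linarith))).ne
  have hG := (lintegral_densG_mul_lt_top hγ.le (p := p) (by linarith)
    ((continuous_gradNormG hγ.le hf).rpow_const fun z => Or.inr (by linarith : 0 ≤ q))
    ((hasCompactSupport_gradNormG (γ := γ) hfc).comp_left
      (g := fun t : ℝ => t ^ q) (Real.zero_rpow (by linarith)))).ne
  have hV := lintegral_angleG_mul_le hγ hp2 hq hf hfc
  have hbox := hC R hR f hf
  have hout := hc R hR f hf
  have hset : {z : GrushinSpace n m | ‖z.1‖ ≤ R ∧ ‖z.2‖ ≤ R ^ (1 + γ)} = boxG n m γ 1 R := by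
    simp [boxG]
  rw [hset] at hout
  have hsum := (lintegral_add_compl (μ := volume)
    (fun z => ENNReal.ofReal (densG γ p z) * ENNReal.ofReal (|f z| ^ q))
    (measurableSet_boxG (n := n) (m := m) (γ := γ) 1 R)).symm.le
  generalize (∫⁻ z, ENNReal.ofReal (densG γ p z) * ENNReal.ofReal (|f z| ^ q)) = F at *
  generalize (∫⁻ z, ENNReal.ofReal (densG γ p z) * ENNReal.ofReal (|f z| ^ (q / 2))) = J at *
  generalize (∫⁻ z, ENNReal.ofReal (densG γ p z) *
    ENNReal.ofReal (gradNormG γ f z ^ q)) = G at *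
  have hs_rpow : 0 ≤ R ^ (-s) := by positivity
  have key : F ≤ ENNReal.ofReal (16 * Real.exp (-(R ^ p))) * G +
      ENNReal.ofReal (Real.exp (C * R ^ p)) * J ^ 2 +
      ENNReal.ofReal (c * R ^ (-s)) * (G + (G + ENNReal.ofReal Q * F)) :=
    hsum.trans (add_le_add hbox (hout.trans (mul_le_mul_right (add_le_add_right hV _) _)))
  lift F to NNReal using hF
  lift J to NNReal using hJ
  lift G to NNReal using hG
  have key' : (F : ℝ) ≤ 16 * Real.exp (-(R ^ p)) * G + Real.exp (C * R ^ p) * (J : ℝ) ^ 2 +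
      c * R ^ (-s) * (G + (G + Q * F)) := by
    have := ENNReal.toReal_mono (by finiteness) key
    rw [ENNReal.toReal_add (by finiteness) (by finiteness),
      ENNReal.toReal_add (by finiteness) (by finiteness), ENNReal.toReal_mul, ENNReal.toReal_mul,
      ENNReal.toReal_mul, ENNReal.toReal_add (by finiteness) (by finiteness),
      ENNReal.toReal_add (by finiteness) (by finiteness), ENNReal.toReal_mul,
      ENNReal.toReal_pow, ENNReal.toReal_ofReal (by positivity),
      ENNReal.toReal_ofReal (by positivity), ENNReal.toReal_ofReal (by positivity),
      ENNReal.toReal_ofReal hQ0] at this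
    exact this
  simp only [ENNReal.coe_toReal]
  have hexp := exp_neg_rpow_le (p := p) hR (tailExp_le hγ.le hp hp2 hq)
  have hE : 2 * Real.exp (C * R ^ p) ≤
      Real.exp ((1 + C * K ^ (p / s)) * (1 + ε ^ (-(p / s)))) := by
    have h1 : C * R ^ p ≤ C * (K ^ (p / s) * (1 + ε ^ (-(p / s)))) :=
      mul_le_mul_of_nonneg_left hRp hC0
    have h2 : (0 : ℝ) ≤ ε ^ (-(p / s)) := by positivity
    calc 2 * Real.exp (C * R ^ p) ≤ Real.exp 1 * Real.exp (C * R ^ p) := by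
          gcongr
          linarith [Real.add_one_le_exp 1]
      _ = Real.exp (1 + C * R ^ p) := (Real.exp_add _ _).symm
      _ ≤ _ := by
          rw [Real.exp_le_exp]
          linarith
  have hGc : (0 : ℝ) ≤ G := G.2
  have hFc : (0 : ℝ) ≤ F := F.2
  have h1 : c * R ^ (-s) * (Q * F) ≤ 1 / 2 * F := by
    have : c * Q * R ^ (-s) ≤ 1 / 2 := by
      rw [hK] at hR1
      nlinarith
    nlinarith
  have h2 : (32 * Real.exp (-(R ^ p)) + 4 * (c * R ^ (-s))) * G ≤ ε * G := by
    gcongr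
    rw [hK] at hRε
    have : 0 ≤ c * Q * R ^ (-s) := by positivity
    linarith
  have h3 : 2 * Real.exp (C * R ^ p) * (J : ℝ) ^ 2 ≤
      Real.exp ((1 + C * K ^ (p / s)) * (1 + ε ^ (-(p / s)))) * (J : ℝ) ^ 2 := by gcongr
  linarith

lemma gradSqG_rpow_half (q : ℝ) (f : GrushinSpace n m → ℝ) (z : GrushinSpace n m) :
    gradSqG n m γ f z ^ (q / 2) = gradNormG γ f z ^ q := by
  rw [gradNormG, Real.sqrt_eq_rpow, ← Real.rpow_mul (gradSqG_nonneg γ f z)]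
  congr 1
  ring

end Grushin

/-- The `q`-super-Poincaré inequality in the Grushin setting for `dμ = Z⁻¹ e^{-N^p} dξ`,
`γ ≥ 1`, `p > γ + 1`, `q = p/(p-1)`, with growth function
`β_q(ε) ∼ exp(C ε^{-(γ+1)(p-1)/(p-γ-1)})`:
`∫ |f|^q dμ ≤ ε ∫ |∇_γ f|^q dμ + exp(C(1 + ε^{-(γ+1)(p-1)/(p-γ-1)})) (∫ |f|^{q/2} dμ)²`. -/
theorem spiq_grushin (n m : ℕ) (hn : 1 ≤ n) (hm : 1 ≤ m) (γ p q : ℝ)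
    (hγ : 1 ≤ γ) (hp : γ + 1 < p) (hq : q = p / (p - 1)) :
    ∃ C > 0, ∀ ε > (0 : ℝ),
      ∀ f : EuclideanSpace ℝ (Fin n) × EuclideanSpace ℝ (Fin m) → ℝ,
      ContDiff ℝ (⊤ : ℕ∞) f → HasCompactSupport f →
      ∫ w, |f w| ^ q ∂(muG n m γ p) ≤
        ε * (∫ w, (gradSqG n m γ f w) ^ (q / 2) ∂(muG n m γ p)) +
          Real.exp (C * (1 + ε ^ (-((γ + 1) * (p - 1) / (p - γ - 1))))) *
            (∫ w, |f w| ^ (q / 2) ∂(muG n m γ p)) ^ 2 := by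
  have hγ0 : 0 ≤ γ := by linarith
  have hp0 : 0 ≤ p := by linarith
  have hq0 : 0 ≤ q := hq ▸ div_nonneg hp0 (by linarith)
  obtain ⟨C, hC0, hC⟩ := exists_toReal_lintegral_densG_le (n := n) (m := m) (γ := γ) (p := p)
    hn (by linarith) (by linarith) (by linarith) hq
  have hζ : 0 ≤ (∫ z : GrushinSpace n m, densG γ p z)⁻¹ :=
    inv_nonneg.2 (integral_nonneg fun z => (densG_pos γ p z).le)
  set ζ := (∫ z : GrushinSpace n m, densG γ p z)⁻¹ with hζ_def
  refine ⟨C + |Real.log ζ| + 1, by positivity, fun ε hε f hf hfc => ?_⟩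
  have hf1 : ContDiff ℝ 1 f := hf.of_le (by exact_mod_cast le_top)
  simp_rw [gradSqG_rpow_half]
  rw [integral_muG hγ0 hp0 (hf.continuous.abs.rpow_const fun z => Or.inr hq0)
      fun z => by positivity,
    integral_muG hγ0 hp0 (hf.continuous.abs.rpow_const fun z => Or.inr (by linarith))
      fun z => by positivity,
    integral_muG hγ0 hp0 ((continuous_gradNormG hγ0 hf1).rpow_const fun z => Or.inr hq0)
      fun z => Real.rpow_nonneg (gradNormG_nonneg γ f z) q, ← hζ_def]
  rcases hζ.eq_or_lt with h0 | hζ0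
  · simp [← h0]
  set t := ε ^ (-((γ + 1) * (p - 1) / (p - γ - 1)))
  have ht : 0 ≤ t := by positivity
  have hE : Real.exp (C * (1 + t)) ≤ Real.exp ((C + |Real.log ζ| + 1) * (1 + t)) * ζ := by
    conv_rhs => rw [← Real.exp_log hζ0, ← Real.exp_add, Real.log_exp]
    rw [Real.exp_le_exp]
    have h1 := neg_abs_le (Real.log ζ)
    have h2 : 0 ≤ |Real.log ζ| * t := by positivity
    linarith
  refine (mul_le_mul_of_nonneg_left (hC ε hε f hf1 hfc) hζ).trans ?_
  rw [mul_add, mul_left_comm, mul_pow]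
  refine add_le_add le_rfl ((mul_le_mul_of_nonneg_left
    (mul_le_mul_of_nonneg_right hE (sq_nonneg _)) hζ).trans (le_of_eq ?_))
  ring
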